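/- Let f₂(x) = (x¹² + 24x¹¹ + 204x¹⁰ + 912x⁹ + 2676x⁸ + 4032x⁷ + 9056x⁶ − 1920x⁵ + 7728x⁴ − 16512x³ − 20544x² − 6912x − 1088) + 608·(x² − 2)³·(x³ + 3x² + 6x + 2) ∈ ℚ[x] (the specialization t ↦ −608 of the family in Theorem 'm11_5er'). Then f₂ is irreducible over ℚ, the Galois group of its splitting field over ℚ has cardinality 720 (it is the Mathieu group M₁₀ acting transitively on the 12 roots), and the root field K = ℚ[x]/(f₂) is a degree-12 number field with discriminant 2³⁸·5¹². -/

import Mathlib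

open Polynomial

/-- `f₂(x) = (x¹² + 24x¹¹ + 204x¹⁰ + 912x⁹ + 2676x⁸ + 4032x⁷ + 9056x⁶ − 1920x⁵ + 7728x⁴
  − 16512x³ − 20544x² − 6912x − 1088) + 608(x²−2)³(x³+3x²+6x+2)` over `ℚ`
  (the specialization `t ↦ −608`). -/
noncomputable def f2 : Polynomial ℚ :=
  (X ^ 12 + 24 * X ^ 11 + 204 * X ^ 10 + 912 * X ^ 9 + 2676 * X ^ 8 + 4032 * X ^ 7 +
      9056 * X ^ 6 - 1920 * X ^ 5 + 7728 * X ^ 4 - 16512 * X ^ 3 - 20544 * X ^ 2 -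
      6912 * X - 1088) +
    C (608 : ℚ) * ((X ^ 2 - 2) ^ 3 * (X ^ 3 + 3 * X ^ 2 + 6 * X + 2))

noncomputable def hZ : ℤ[X] :=
  X ^ 12 - 4 * X ^ 11 - 16 * X ^ 10 + 80 * X ^ 9 + 220 * X ^ 8 - 760 * X ^ 7 - 1200 * X ^ 6
    - 560 * X ^ 5 + 1915 * X ^ 4 - 940 * X ^ 3 + 320 * X ^ 2 + 960 * X - 410

noncomputable def fZ : ℤ[X] :=
  X ^ 12 + 24 * X ^ 11 + 204 * X ^ 10 + 1520 * X ^ 9 + 4500 * X ^ 8 + 4032 * X ^ 7 - 672 * X ^ 6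
    - 16512 * X ^ 5 + 22320 * X ^ 4 + 22400 * X ^ 3 - 20544 * X ^ 2 - 36096 * X - 10816

lemma fZ_map : fZ.map (Int.castRingHom ℚ) = f2 := by
  simp only [fZ, f2, Polynomial.map_add, Polynomial.map_sub, Polynomial.map_mul,
    Polynomial.map_pow, Polynomial.map_X, Polynomial.map_ofNat]
  have : (C (608:ℚ) : ℚ[X]) = 608 := rfl
  rw [this]; ring

lemma hZ_deg : hZ.natDegree = 12 := by unfold hZ; compute_degree!
lemma hZ_monic : hZ.Monic := by unfold hZ; monicity!
lemma fZ_deg : fZ.natDegree = 12 := by unfold fZ; compute_degree!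
lemma fZ_monic : fZ.Monic := by unfold fZ; monicity!

lemma f2_deg : f2.natDegree = 12 := by
  rw [← fZ_map, fZ_monic.natDegree_map, fZ_deg]
lemma f2_monic : f2.Monic := by
  rw [← fZ_map]; exact fZ_monic.map _

lemma fac_aux {k : Type*} [Field k] (p q : k[X]) (a b : k) (m n : ℕ)
    (h : p * q = (X - C a) ^ m * (X - C b) ^ n) (ha : p.eval a ≠ 0) :
    p ∣ (X - C b) ^ n := by
  have hc : IsCoprime p ((X - C a) ^ m) := by
    apply IsCoprime.pow_right
    rw [isCoprime_comm]
    exact (irreducible_X_sub_C a).coprime_iff_not_dvd.2 (by rwa [dvd_iff_isRoot])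
  exact hc.dvd_of_dvd_mul_left ⟨q, h.symm⟩

lemma deg_le_aux {k : Type*} [Field k] (p q : k[X]) (a b : k) (m n : ℕ)
    (h : p * q = (X - C a) ^ m * (X - C b) ^ n) (ha : p.eval a ≠ 0) :
    p.natDegree ≤ n := by
  have := natDegree_le_of_dvd (fac_aux p q a b m n h ha) (pow_ne_zero _ (X_sub_C_ne_zero b))
  simpa [natDegree_pow] using this

lemma deg_zero_aux {k : Type*} [Field k] (p q : k[X]) (a b : k) (m n : ℕ)
    (h : p * q = (X - C a) ^ m * (X - C b) ^ n) (ha : p.eval a ≠ 0) (hb : p.eval b ≠ 0) :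
    p.natDegree = 0 := by
  obtain ⟨q', hq⟩ := fac_aux p q a b m n h ha
  have := deg_le_aux p q' a b 0 n (by simpa using hq.symm) ha
  have := deg_le_aux p q' b a n 0 (by simpa using hq.symm) hb
  omega

lemma hZ_map2 : hZ.map (Int.castRingHom (ZMod 2)) = (X - C 0) ^ 4 * (X - C 1) ^ 8 := by
  have h2 : (2 : (ZMod 2)[X]) = 0 := by
    have : (C (2 : ZMod 2) : (ZMod 2)[X]) = 2 := rfl
    rw [← this, show (2 : ZMod 2) = 0 from rfl, C_0]
  simp only [hZ, Polynomial.map_add, Polynomial.map_sub, Polynomial.map_mul,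
    Polynomial.map_pow, Polynomial.map_X, Polynomial.map_ofNat, C_0, C_1]
  linear_combination (2 * X ^ 11 - 22 * X ^ 10 + 68 * X ^ 9 + 75 * X ^ 8 - 352 * X ^ 7 - 614 * X ^ 6
    - 276 * X ^ 5 + 957 * X ^ 4 - 470 * X ^ 3 + 160 * X ^ 2 + 480 * X - 205) * h2

lemma hZ_map5 : hZ.map (Int.castRingHom (ZMod 5)) = (X - C 0) ^ 10 * (X - C 2) ^ 2 := by
  have h2 : (5 : (ZMod 5)[X]) = 0 := by
    have : (C (5 : ZMod 5) : (ZMod 5)[X]) = 5 := rfl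
    rw [← this, show (5 : ZMod 5) = 0 from rfl, C_0]
  have h3 : (C 2 : (ZMod 5)[X]) = 2 := rfl
  simp only [hZ, Polynomial.map_add, Polynomial.map_sub, Polynomial.map_mul,
    Polynomial.map_pow, Polynomial.map_X, Polynomial.map_ofNat, C_0, h3]
  linear_combination (- 4 * X ^ 10 + 16 * X ^ 9 + 44 * X ^ 8 - 152 * X ^ 7 - 240 * X ^ 6
    - 112 * X ^ 5 + 383 * X ^ 4 - 188 * X ^ 3 + 64 * X ^ 2 + 192 * X - 82) * h2

lemma hZ_irr : Irreducible hZ := by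
  rw [hZ_monic.irreducible_iff_natDegree']
  refine ⟨by intro h; simpa [h] using hZ_deg, ?_⟩
  intro f g hf hg hfg hd
  rw [hZ_deg, Finset.mem_Ioc] at hd
  have hdeg : f.natDegree + g.natDegree = 12 := by
    rw [← hf.natDegree_mul hg, hfg, hZ_deg]
  have key : ∀ (p : ℕ) [Fact p.Prime] (c : ℤ), ¬ (p * p : ℤ) ∣ hZ.eval c →
      (f.map (Int.castRingHom (ZMod p))).eval (c : ZMod p) ≠ 0 ∨
      (g.map (Int.castRingHom (ZMod p))).eval (c : ZMod p) ≠ 0 := by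
    intro p _ c hc
    by_contra! hcon
    apply hc
    rw [← hfg, eval_mul]
    have e : ∀ q : ℤ[X], (q.map (Int.castRingHom (ZMod p))).eval (c : ZMod p) = ((q.eval c : ℤ) : ZMod p) := by
      intro q
      have := Polynomial.eval_intCast_map (Int.castRingHom (ZMod p)) q c
      simpa using this
    rw [e, e, ZMod.intCast_zmod_eq_zero_iff_dvd, ZMod.intCast_zmod_eq_zero_iff_dvd] at hcon
    exact mul_dvd_mul hcon.1 hcon.2
  haveI : Fact (Nat.Prime 2) := ⟨by norm_num⟩
  haveI : Fact (Nat.Prime 5) := ⟨by norm_num⟩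
  have m2 : f.map (Int.castRingHom (ZMod 2)) * g.map (Int.castRingHom (ZMod 2)) = (X - C 0) ^ 4 * (X - C 1) ^ 8 := by
    rw [← Polynomial.map_mul, hfg, hZ_map2]
  have m5 : f.map (Int.castRingHom (ZMod 5)) * g.map (Int.castRingHom (ZMod 5)) = (X - C 0) ^ 10 * (X - C 2) ^ 2 := by
    rw [← Polynomial.map_mul, hfg, hZ_map5]
  have k1 := key 2 0 (by norm_num [hZ])
  have k2 := key 2 1 (by norm_num [hZ])
  have k3 := key 5 0 (by norm_num [hZ])
  have k4 := key 5 2 (by norm_num [hZ])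
  have df2 : (f.map (Int.castRingHom (ZMod 2))).natDegree = f.natDegree := hf.natDegree_map _
  have dg2 : (g.map (Int.castRingHom (ZMod 2))).natDegree = g.natDegree := hg.natDegree_map _
  have df5 : (f.map (Int.castRingHom (ZMod 5))).natDegree = f.natDegree := hf.natDegree_map _
  have dg5 : (g.map (Int.castRingHom (ZMod 5))).natDegree = g.natDegree := hg.natDegree_map _
  simp only [Int.cast_zero, Int.cast_one, Int.cast_ofNat] at k1 k2 k3 k4
  generalize f.map (Int.castRingHom (ZMod 2)) = F2 at *
  generalize g.map (Int.castRingHom (ZMod 2)) = G2 at *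
  generalize f.map (Int.castRingHom (ZMod 5)) = F5 at *
  generalize g.map (Int.castRingHom (ZMod 5)) = G5 at *
  have A : ∀ {k : Type} [Field k] (p q : k[X]) (a b : k) (m n : ℕ),
    p * q = (X - C a) ^ m * (X - C b) ^ n → p.eval a ≠ 0 ∨ q.eval a ≠ 0 →
    p.eval b ≠ 0 ∨ q.eval b ≠ 0 → p.natDegree = 0 ∨ q.natDegree = 0 ∨
      (p.natDegree ≤ n ∧ q.natDegree ≤ m) ∨ (p.natDegree ≤ m ∧ q.natDegree ≤ n) := by
    intro k _ p q a b m n h h1 h2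
    have h' : q * p = (X - C a) ^ m * (X - C b) ^ n := by rw [mul_comm, h]
    have h'' : p * q = (X - C b) ^ n * (X - C a) ^ m := by rw [h, mul_comm]
    have h''' : q * p = (X - C b) ^ n * (X - C a) ^ m := by rw [mul_comm, h'']
    rcases h1 with h1 | h1 <;> rcases h2 with h2 | h2
    · exact Or.inl (deg_zero_aux _ _ _ _ _ _ h h1 h2)
    · exact Or.inr (Or.inr (Or.inl ⟨deg_le_aux _ _ _ _ _ _ h h1, deg_le_aux _ _ _ _ _ _ h''' h2⟩))
    · exact Or.inr (Or.inr (Or.inr ⟨deg_le_aux _ _ _ _ _ _ h'' h2, deg_le_aux _ _ _ _ _ _ h' h1⟩))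
    · exact Or.inr (Or.inl (deg_zero_aux _ _ _ _ _ _ h' h1 h2))
  have r2 := A _ _ _ _ _ _ m2 k1 k2
  have r5 := A _ _ _ _ _ _ m5 k3 k4
  rw [df2, dg2] at r2
  rw [df5, dg5] at r5
  omega

set_option maxHeartbeats 4000000 in
lemma theta_root {E : Type*} [Field E] [CharZero E] (x : E)
    (hf : x ^ 12 + 24 * x ^ 11 + 204 * x ^ 10 + 1520 * x ^ 9 + 4500 * x ^ 8 + 4032 * x ^ 7
      - 672 * x ^ 6 - 16512 * x ^ 5 + 22320 * x ^ 4 + 22400 * x ^ 3 - 20544 * x ^ 2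
      - 36096 * x - 10816 = 0) :
    ∃ y : E, y ^ 12 - 4 * y ^ 11 - 16 * y ^ 10 + 80 * y ^ 9 + 220 * y ^ 8 - 760 * y ^ 7
      - 1200 * y ^ 6 - 560 * y ^ 5 + 1915 * y ^ 4 - 940 * y ^ 3 + 320 * y ^ 2 + 960 * y - 410 = 0 := by
  obtain ⟨y, hy⟩ : ∃ y : E, y = (283/4050) + (24889/16200)*x + (-54253/64800)*x^2 + (941/10800)*x^3 + (281/1620)*x^4 + (17/600)*x^5 + (-1237/32400)*x^6 + (-119/2400)*x^7 + (-2003/129600)*x^8 + (-109/51840)*x^9 + (-247/1036800)*x^10 + (-1/103680)*x^11 := ⟨_, rfl⟩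
  refine ⟨y, ?_⟩
  have h2 : y ^ 2 = (-691/5400) + (-3283/32400)*x + (25613/10800)*x^2 + (-8947/4050)*x^3 + (27653/32400)*x^4 + (-1117/32400)*x^5 + (7787/64800)*x^6 + (-146/2025)*x^7 + (-14333/259200)*x^8 + (-3877/518400)*x^9 + (-187/172800)*x^10 + (-13/259200)*x^11 := by
    linear_combination y * hy + ((283/4050) + (24889/16200)*x + (-54253/64800)*x^2 + (941/10800)*x^3 + (281/1620)*x^4 + (17/600)*x^5 + (-1237/32400)*x^6 + (-119/2400)*x^7 + (-2003/129600)*x^8 + (-109/51840)*x^9 + (-247/1036800)*x^10 + (-1/103680)*x^11) * hy + ((-25787/2099520000) + (49423/4199040000)*x + (-13771/3359232000)*x^2 + (-2033/1244160000)*x^3 + (-55787/89579520000)*x^4 + (2617/6718464000)*x^5 + (145121/268738560000)*x^6 + (10579/67184640000)*x^7 + (23249/1074954240000)*x^8 + (127/53747712000)*x^9 + (1/10749542400)*x^10) * hf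
  have h3 : y ^ 3 = (-25849/12960) + (-407833/64800)*x + (-237869/129600)*x^2 + (45169/5184)*x^3 + (-27683/10800)*x^4 + (-65519/64800)*x^5 + (355/1728)*x^6 + (30769/32400)*x^7 + (8537/23040)*x^8 + (52517/1036800)*x^9 + (12937/2073600)*x^10 + (551/2073600)*x^11 := by
    linear_combination y * h2 + ((-691/5400) + (-3283/32400)*x + (25613/10800)*x^2 + (-8947/4050)*x^3 + (27653/32400)*x^4 + (-1117/32400)*x^5 + (7787/64800)*x^6 + (-146/2025)*x^7 + (-14333/259200)*x^8 + (-3877/518400)*x^9 + (-187/172800)*x^10 + (-13/259200)*x^11) * hy + ((-513901/2799360000) + (832961/16796160000)*x + (178613/67184640000)*x^2 + (-952679/134369280000)*x^3 + (30443/134369280000)*x^4 + (-245753/134369280000)*x^5 + (250031/268738560000)*x^6 + (99953/179159040000)*x^7 + (41969/537477120000)*x^8 + (181/16796160000)*x^9 + (13/26873856000)*x^10) * hf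
  have h4 : y ^ 4 = (17951/4050) + (325259/32400)*x + (-172057/32400)*x^2 + (-653399/64800)*x^3 + (46841/5400)*x^4 + (-6071/8100)*x^5 + (-279/200)*x^6 + (-34949/64800)*x^7 + (-3713/21600)*x^8 + (-10819/518400)*x^9 + (-1267/518400)*x^10 + (-109/1036800)*x^11 := by
    linear_combination y * h3 + ((-25849/12960) + (-407833/64800)*x + (-237869/129600)*x^2 + (45169/5184)*x^3 + (-27683/10800)*x^4 + (-65519/64800)*x^5 + (355/1728)*x^6 + (30769/32400)*x^7 + (8537/23040)*x^8 + (52517/1036800)*x^9 + (12937/2073600)*x^10 + (551/2073600)*x^11) * hy + ((1419883/3359232000) + (-3549197/22394880000)*x + (-80393/5971968000)*x^2 + (6011723/268738560000)*x^3 + (8836097/537477120000)*x^4 + (-29371/35831808000)*x^5 + (-11462741/1074954240000)*x^6 + (-809377/214990848000)*x^7 + (-375157/716636160000)*x^8 + (-14803/238878720000)*x^9 + (-551/214990848000)*x^10) * hf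
  have hP : y ^ 4 - 4 * y ^ 3 - 16 * y ^ 2 + 80 * y + 220 = (1296259/5400) + (575077/3600)*x + (-277811/2700)*x^2 + (-56579/21600)*x^3 + (103399/5400)*x^4 + (33011/5400)*x^5 + (-77693/10800)*x^6 + (-154463/21600)*x^7 + (-173291/86400)*x^8 + (-1741/6400)*x^9 + (-1259/43200)*x^10 + (-131/115200)*x^11 := by
    linear_combination h4 - 4 * h3 - 16 * h2 + 80 * hy
  have hQ : (y ^ 4 - 4 * y ^ 3 - 16 * y ^ 2 + 80 * y + 220) * y ^ 4
      - 760 * y ^ 3 - 1200 * y ^ 2 - 560 * y + 1915 = (19386211/5400) + (1592501/360)*x + (-9335597/10800)*x^2 + (-56156593/10800)*x^3 + (11612209/5400)*x^4 + (1322903/5400)*x^5 + (-2881757/10800)*x^6 + (-2991611/5400)*x^7 + (-18484319/86400)*x^8 + (-833077/28800)*x^9 + (-616631/172800)*x^10 + (-8789/57600)*x^11 := by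
    rw [hP]
    linear_combination ((1296259/5400) + (575077/3600)*x + (-277811/2700)*x^2 + (-56579/21600)*x^3 + (103399/5400)*x^4 + (33011/5400)*x^5 + (-77693/10800)*x^6 + (-154463/21600)*x^7 + (-173291/86400)*x^8 + (-1741/6400)*x^9 + (-1259/43200)*x^10 + (-131/115200)*x^11) * h4 + ((-131892611/1399680000) + (686024083/11197440000)*x + (-63582191/22394880000)*x^2 + (-15353051/1244160000)*x^3 + (10398353/5598720000)*x^4 + (43164661/22394880000)*x^5 + (38146847/44789760000)*x^6 + (10028303/44789760000)*x^7 + (311251/11197440000)*x^8 + (532811/179159040000)*x^9 + (14279/119439360000)*x^10) * hf - 760 * h3 - 1200 * h2 - 560 * hy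
  have hR : ((y ^ 4 - 4 * y ^ 3 - 16 * y ^ 2 + 80 * y + 220) * y ^ 4
      - 760 * y ^ 3 - 1200 * y ^ 2 - 560 * y + 1915) * y ^ 4 - 940 * y ^ 3 + 320 * y ^ 2 + 960 * y - 410 = 0 := by
    rw [hQ]
    linear_combination ((19386211/5400) + (1592501/360)*x + (-9335597/10800)*x^2 + (-56156593/10800)*x^3 + (11612209/5400)*x^4 + (1322903/5400)*x^5 + (-2881757/10800)*x^6 + (-2991611/5400)*x^7 + (-18484319/86400)*x^8 + (-833077/28800)*x^9 + (-616631/172800)*x^10 + (-8789/57600)*x^11) * h4 + ((-2252128319/1399680000) + (-5099592689/11197440000)*x + (13614980161/5598720000)*x^2 + (-2456273329/1866240000)*x^3 + (52185367/4478976000)*x^4 + (1909914131/11197440000)*x^5 + (3009473789/44789760000)*x^6 + (546169999/22394880000)*x^7 + (265195703/89579520000)*x^8 + (13010137/35831808000)*x^9 + (958001/59719680000)*x^10) * hf - 940 * h3 + 320 * h2 + 960 * hy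
  linear_combination hR

lemma hZ_irrQ : Irreducible (hZ.map (Int.castRingHom ℚ)) :=
  (hZ_monic.irreducible_iff_irreducible_map_fraction_map (K := ℚ)).1 hZ_irr

lemma aeval_f2 {E : Type*} [Field E] [CharZero E] [Algebra ℚ E] (x : E) : aeval x f2 =
    x ^ 12 + 24 * x ^ 11 + 204 * x ^ 10 + 1520 * x ^ 9 + 4500 * x ^ 8 + 4032 * x ^ 7
      - 672 * x ^ 6 - 16512 * x ^ 5 + 22320 * x ^ 4 + 22400 * x ^ 3 - 20544 * x ^ 2
      - 36096 * x - 10816 := by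
  rw [← fZ_map]
  simp only [fZ, Polynomial.map_add, Polynomial.map_sub, Polynomial.map_mul,
    Polynomial.map_pow, Polynomial.map_X, Polynomial.map_ofNat, map_add, map_sub, map_mul, map_pow,
    aeval_X, map_ofNat]

lemma aeval_hZ {E : Type*} [Field E] [CharZero E] [Algebra ℚ E] (y : E) :
    aeval y (hZ.map (Int.castRingHom ℚ)) =
    y ^ 12 - 4 * y ^ 11 - 16 * y ^ 10 + 80 * y ^ 9 + 220 * y ^ 8 - 760 * y ^ 7
      - 1200 * y ^ 6 - 560 * y ^ 5 + 1915 * y ^ 4 - 940 * y ^ 3 + 320 * y ^ 2 + 960 * y - 410 := by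
  simp only [hZ, Polynomial.map_add, Polynomial.map_sub, Polynomial.map_mul,
    Polynomial.map_pow, Polynomial.map_X, Polynomial.map_ofNat, map_add, map_sub, map_mul, map_pow,
    aeval_X, map_ofNat]

lemma hQ_minpoly {E : Type*} [Field E] [CharZero E] [Algebra ℚ E] (y : E)
    (hy : aeval y (hZ.map (Int.castRingHom ℚ)) = 0) :
    minpoly ℚ y = hZ.map (Int.castRingHom ℚ) :=
  (minpoly.eq_of_irreducible_of_monic hZ_irrQ hy (hZ_monic.map _)).symm

lemma minpoly_deg_le_aux {k E : Type*} [Field k] [Field E] [Algebra k E] (x : E)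
    (hint : IsIntegral k x) (y : IntermediateField.adjoin k {x}) :
    (minpoly k y).natDegree ≤ (minpoly k x).natDegree := by
  haveI := IntermediateField.adjoin.finiteDimensional hint
  rw [← IntermediateField.adjoin.finrank hint]
  exact minpoly.natDegree_le y

lemma f2_minpoly {E : Type*} [Field E] [CharZero E] [Algebra ℚ E] (x : E)
    (hx : aeval x f2 = 0) : minpoly ℚ x = f2 := by
  have hint : IsIntegral ℚ x := ⟨f2, f2_monic, hx⟩
  have hx' := hx
  rw [aeval_f2] at hx'
  -- a root of `hZ` inside `ℚ(x)`
  have hx2 : aeval (IntermediateField.AdjoinSimple.gen ℚ x) f2 = 0 := by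
    apply (algebraMap (IntermediateField.adjoin ℚ {x}) E).injective
    rw [← Polynomial.aeval_algebraMap_apply, IntermediateField.AdjoinSimple.algebraMap_gen, hx, map_zero]
  rw [aeval_f2] at hx2
  obtain ⟨y, hy⟩ := theta_root _ hx2
  rw [← aeval_hZ] at hy
  have hm := hQ_minpoly y hy
  have h1 := minpoly_deg_le_aux x hint y
  have h2 : (minpoly ℚ y).natDegree ≤ (minpoly ℚ x).natDegree := by
    convert h1 <;> first | rfl | exact Subsingleton.elim _ _
  rw [hm, hZ_monic.natDegree_map, hZ_deg] at h2
  refine (Polynomial.eq_of_monic_of_dvd_of_natDegree_le (minpoly.monic hint) f2_monic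
    (minpoly.dvd ℚ x hx) ?_).symm
  rw [f2_deg]; exact h2

lemma f2_irr : Irreducible f2 := by
  obtain ⟨x, hx⟩ := IsAlgClosed.exists_aeval_eq_zero (AlgebraicClosure ℚ) f2
    (by rw [degree_eq_natDegree f2_monic.ne_zero, f2_deg]; decide)
  rw [← f2_minpoly x hx]
  exact minpoly.irreducible ⟨f2, f2_monic, hx⟩

lemma exists_pb {K : Type*} [Field K] [NumberField K] (x : K)
    (h : (minpoly ℚ x).natDegree = Module.finrank ℚ K) : ∃ pb : PowerBasis ℚ K, pb.gen = x := by
  have h1 := (Field.primitive_element_iff_minpoly_natDegree_eq ℚ x).2 h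
  have hi : IsIntegral ℚ x := Algebra.IsIntegral.isIntegral x
  have h2 : Algebra.adjoin ℚ {x} = ⊤ := by
    rw [← IntermediateField.adjoin_simple_toSubalgebra_of_isAlgebraic hi.isAlgebraic, h1]
    rfl
  exact ⟨PowerBasis.ofAdjoinEqTop hi h2, by simp⟩

lemma norm_sub_eq {K : Type*} [Field K] [NumberField K] (x : K)
    (h : (minpoly ℚ x).natDegree = Module.finrank ℚ K) (c : ℚ) :
    Algebra.norm ℚ (algebraMap ℚ K c - x) = (minpoly ℚ x).eval c := by
  obtain ⟨pb, rfl⟩ := exists_pb x h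
  rw [← charpoly_leftMulMatrix pb, Matrix.eval_charpoly, Algebra.norm_eq_matrix_det pb.basis, map_sub,
    AlgHom.commutes]
  rfl

open NumberField in
lemma pmax {K : Type*} [Field K] [NumberField K] (p : ℕ) [Fact p.Prime] (h : ℤ[X])
    (hm : h.Monic) (hd : h.natDegree = 12) (hK : Module.finrank ℚ K = 12) (θ : 𝓞 K)
    (hmin : minpoly ℚ (θ : K) = h.map (Int.castRingHom ℚ))
    (hs : (h.map (Int.castRingHom (ZMod p))).Splits)
    (hv : ∀ c : ZMod p, ¬ (p : ℤ) ^ 2 ∣ h.eval (c.val : ℤ))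
    (q : ℤ[X]) (hq : q.degree < 12) (w : 𝓞 K) (hw : aeval θ q = p * w) :
    q.map (Int.castRingHom (ZMod p)) = 0 := by
  classical
  have hp : p.Prime := Fact.out
  have hθ : aeval θ h = 0 := by
    apply RingOfIntegers.coe_injective
    have := minpoly.aeval ℚ (θ : K)
    rw [hmin] at this
    have e : algebraMap (𝓞 K) K (aeval θ h) = aeval (θ : K) h := by
      rw [← Polynomial.aeval_algebraMap_apply]
    rw [map_zero]
    refine e.trans ?_
    rw [← this, show Int.castRingHom ℚ = algebraMap ℤ ℚ from rfl, Polynomial.aeval_map_algebraMap]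
  by_contra hq0
  set φ := Int.castRingHom (ZMod p) with hφ
  have hsurj : Function.Surjective (Polynomial.map φ) := Polynomial.map_surjective φ (ZMod.ringHom_surjective φ)
  set qb := q.map φ with hqb
  set hb := h.map φ with hhb
  have hb0 : hb ≠ 0 := (hm.map φ).ne_zero
  set g := EuclideanDomain.gcd qb hb with hg
  have hgab := EuclideanDomain.gcd_eq_gcd_ab qb hb
  obtain ⟨k, hk⟩ : g ∣ hb := EuclideanDomain.gcd_dvd_right qb hb
  obtain ⟨A, hA⟩ := hsurj (EuclideanDomain.gcdA qb hb)
  obtain ⟨B, hB⟩ := hsurj (EuclideanDomain.gcdB qb hb)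
  have hk0 : k ≠ 0 := by rintro rfl; simp at hk; exact hb0 hk
  have hkd : k.degree ≠ 0 := by
    intro hk1
    have h1 : g.degree = hb.degree := by rw [hk, degree_mul, hk1, add_zero]
    have h2 : g.degree ≤ qb.degree := degree_le_of_dvd (EuclideanDomain.gcd_dvd_left qb hb) hq0
    have h3 : qb.degree ≤ q.degree := degree_map_le
    have h4 : hb.degree = 12 := by
      rw [hm.degree_map, degree_eq_natDegree hm.ne_zero, hd]; rfl
    rw [h1, h4] at h2
    exact absurd (h2.trans h3) (not_le.2 hq)
  obtain ⟨c, hc⟩ := (hs.of_dvd hb0 ⟨g, by rw [hk, mul_comm]⟩ : k.Splits).exists_eval_eq_zero hkd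
  obtain ⟨k', hk'⟩ := dvd_iff_isRoot.2 hc
  obtain ⟨K', hK'⟩ := hsurj k'
  set c' : ℤ := (c.val : ℤ) with hc'
  have hcc : φ c' = c := by simp [hφ, hc']
  set G := K' * (q * A + h * B) with hG
  have hGm : ((X - C c') * G - h).map φ = 0 := by
    rw [hG]
    simp only [Polynomial.map_sub, Polynomial.map_mul, Polynomial.map_add, map_X, map_C, hA, hB, hK', hcc]
    rw [← hqb, ← hhb, ← hgab, ← hg, sub_eq_zero]
    rw [hk, hk']; ring
  obtain ⟨T, hT⟩ : C (p : ℤ) ∣ (X - C c') * G - h := by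
    rw [C_dvd_iff_dvd_coeff]
    intro i
    have := congrArg (fun f => f.coeff i) hGm
    simp only [coeff_map, coeff_zero] at this
    exact (ZMod.intCast_zmod_eq_zero_iff_dvd _ p).1 this
  have hTc : (p : ℤ) * T.eval c' = - h.eval c' := by
    have := congrArg (Polynomial.eval c') hT
    simp at this
    linarith
  obtain ⟨T1, hT1⟩ := (X_sub_C_dvd_sub_C_eval : X - C c' ∣ T - C (eval c' T))
  have hθG : (θ - (c' : 𝓞 K)) * ((aeval θ K') * w * aeval θ A) = aeval θ T := by
    have h0 : ((p : ℤ) : 𝓞 K) ≠ 0 := by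
      simpa using hp.ne_zero
    apply mul_left_cancel₀ h0
    have := congrArg (aeval θ) hT
    rw [hG] at this
    simp only [map_sub, map_mul, map_add, aeval_X, aeval_C, hθ, hw, algebraMap_int_eq, eq_intCast, map_intCast, map_natCast] at this
    push_cast at this ⊢
    linear_combination this
  have hdvd : ((c' : 𝓞 K) - θ) ∣ ((T.eval c' : ℤ) : 𝓞 K) := by
    have := congrArg (aeval θ) hT1
    simp only [map_sub, map_mul, aeval_X, aeval_C, algebraMap_int_eq, eq_intCast, map_intCast, map_natCast] at this
    refine ⟨aeval θ T1 - (aeval θ K') * w * aeval θ A, ?_⟩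
    linear_combination -this - hθG
  have hn := map_dvd (Algebra.norm ℤ) hdvd
  have hn1 : Algebra.norm ℤ ((c' : 𝓞 K) - θ) = h.eval c' := by
    have : ((Algebra.norm ℤ ((c' : 𝓞 K) - θ) : ℤ) : ℚ) = (h.eval c' : ℤ) := by
      rw [Algebra.coe_norm_int]
      have e := norm_sub_eq (θ : K) (by rw [hmin, hm.natDegree_map, hd, hK]) (c' : ℚ)
      rw [hmin, Polynomial.eval_intCast_map] at e
      simpa using e
    exact_mod_cast this
  have hn2 : Algebra.norm ℤ ((T.eval c' : ℤ) : 𝓞 K) = T.eval c' ^ Module.finrank ℤ (𝓞 K) := by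
    have := Algebra.norm_algebraMap (R := ℤ) (S := 𝓞 K) (T.eval c')
    simpa using this
  rw [hn1, hn2] at hn
  have hpT : (p : ℤ) ∣ T.eval c' := by
    have : (p : ℤ) ∣ h.eval c' := ⟨- T.eval c', by linarith⟩
    exact (Nat.prime_iff_prime_int.1 hp).dvd_of_dvd_pow (this.trans hn)
  obtain ⟨t, ht⟩ := hpT
  exact hv c ⟨-t, by rw [ht] at hTc; linear_combination hTc⟩

open NumberField in
lemma disc_index {K : Type*} [Field K] [NumberField K] (h : ℤ[X])
    (hm : h.Monic) (hd : h.natDegree = 12) (hK : Module.finrank ℚ K = 12) (θ : 𝓞 K)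
    (hmin : minpoly ℚ (θ : K) = h.map (Int.castRingHom ℚ)) :
    ∃ P : Matrix (Fin 12) (Fin 12) ℤ,
      Algebra.norm ℚ (aeval (θ : K) (derivative (h.map (Int.castRingHom ℚ)))) =
        (P.det : ℚ) ^ 2 * (discr K : ℚ) ∧
      ∀ (p : ℕ) [Fact p.Prime], (p : ℤ) ∣ P.det → ∃ (q : ℤ[X]) (w : 𝓞 K), q.degree < 12 ∧
        q.map (Int.castRingHom (ZMod p)) ≠ 0 ∧ aeval θ q = p * w := by
  classical
  have hdm : (minpoly ℚ (θ : K)).natDegree = 12 := by rw [hmin, hm.natDegree_map, hd]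
  obtain ⟨pb, hpb⟩ := exists_pb (θ : K) (by rw [hdm, hK])
  have hcard : Fintype.card (Module.Free.ChooseBasisIndex ℤ (𝓞 K)) = 12 := by
    rw [← Module.finrank_eq_card_chooseBasisIndex, RingOfIntegers.rank, hK]
  let ε := Fintype.equivFinOfCardEq hcard
  let e := (RingOfIntegers.basis K).reindex ε
  let eK := (integralBasis K).reindex ε
  let P : Matrix (Fin 12) (Fin 12) ℤ := fun i j => e.repr (θ ^ (i : ℕ)) j
  have hPe : ∀ i : Fin 12, θ ^ (i : ℕ) = ∑ j, P i j • e j := fun i => (e.sum_repr _).symm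
  have heK : ∀ j, eK j = (e j : K) := by
    intro j
    simp only [eK, e, Module.Basis.reindex_apply]
    exact integralBasis_apply K _
  refine ⟨P, ?_, ?_⟩
  · have h1 : Algebra.discr ℚ (fun i : Fin 12 => (θ : K) ^ (i : ℕ)) =
        (P.det : ℚ) ^ 2 * (discr K : ℚ) := by
      have h2 := Algebra.discr_of_matrix_mulVec (A := ℚ) (⇑eK) (P.map (Int.castRingHom ℚ))
      have h3 : ((P.map (Int.castRingHom ℚ)).map (algebraMap ℚ K)).mulVec ⇑eK =
          fun i : Fin 12 => (θ : K) ^ (i : ℕ) := by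
        funext i
        have := congrArg (fun z : 𝓞 K => (z : K)) (hPe i)
        simp only [map_pow, map_sum, map_zsmul] at this
        rw [this]
        simp only [Matrix.mulVec, dotProduct, Matrix.map_apply, heK]
        refine Finset.sum_congr rfl fun j _ => ?_
        simp [zsmul_eq_mul]
      rw [h3] at h2
      rw [h2]
      have h4 : Algebra.discr ℚ ⇑eK = discr K := by
        rw [coe_discr]
        have := Algebra.discr_reindex ℚ (integralBasis K) ε
        rw [← this]
        congr 1
        funext i
        simp [eK]
      have h5 : (P.map (Int.castRingHom ℚ)).det = (P.det : ℚ) := by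
        have := (Int.castRingHom ℚ).map_det P
        rw [eq_intCast] at this
        rw [this]; rfl
      rw [h4, h5]
    rw [← h1]
    have hdim : pb.dim = 12 := by rw [← pb.finrank, hK]
    have h6 := Algebra.discr_powerBasis_eq_norm ℚ pb
    rw [hK, hpb, hmin] at h6
    rw [show (-1 : ℚ) ^ (12 * (12 - 1) / 2) = 1 by norm_num, one_mul] at h6
    rw [← h6]
    have := Algebra.discr_reindex ℚ pb.basis (finCongr hdim)
    rw [← this]
    congr 1
    funext i
    simp [hpb]
  · intro p _ hp
    have h1 : (P.map (Int.castRingHom (ZMod p))).det = 0 := by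
      have := (Int.castRingHom (ZMod p)).map_det P
      rw [eq_intCast, (ZMod.intCast_zmod_eq_zero_iff_dvd _ p).2 hp] at this
      rw [this]; rfl
    obtain ⟨v, hv0, hv⟩ := Matrix.exists_vecMul_eq_zero_iff.2 h1
    have hl : ∀ i, ∃ u : ℤ, (u : ZMod p) = v i := fun i => ZMod.intCast_surjective (v i)
    choose u hu using hl
    have hdv : ∀ j, ∃ t : ℤ, ∑ i, u i * P i j = p * t := by
      intro j
      have := congrFun hv j
      simp only [Matrix.vecMul, dotProduct, Matrix.map_apply, ← hu, Pi.zero_apply] at this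
      apply (ZMod.intCast_zmod_eq_zero_iff_dvd _ p).1
      push_cast
      simpa using this
    choose t ht using hdv
    have hcoef : ∀ i : Fin 12, (∑ k : Fin 12, C (u k) * X ^ (k : ℕ) : ℤ[X]).coeff i = u i := by
      intro i
      simp only [finsetSum_coeff, coeff_C_mul, coeff_X_pow]
      rw [Finset.sum_eq_single i]
      · simp
      · intro b _ hb
        rw [if_neg (fun h => hb (Fin.ext h.symm))]; simp
      · simp
    refine ⟨∑ i : Fin 12, C (u i) * X ^ (i : ℕ), ∑ j, t j • e j, ?_, ?_, ?_⟩
    · refine (degree_sum_le _ _).trans_lt ?_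
      rw [Finset.sup_lt_iff (by exact WithBot.bot_lt_coe 12)]
      intro i _
      refine (degree_C_mul_X_pow_le _ _).trans_lt ?_
      exact_mod_cast i.2
    · intro h0
      apply hv0
      funext i
      have := congrArg (fun f => f.coeff (i : ℕ)) h0
      simp only [coeff_map, coeff_zero, hcoef] at this
      rw [← hu]; simpa using this
    · simp only [map_sum, map_mul, aeval_C, aeval_X, map_pow, algebraMap_int_eq, eq_intCast]
      have : ∀ i : Fin 12, (u i : 𝓞 K) * θ ^ (i : ℕ) = ∑ j, (u i * P i j) • e j := by
        intro i
        rw [hPe i, Finset.mul_sum]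
        refine Finset.sum_congr rfl fun j _ => ?_
        simp only [zsmul_eq_mul]; push_cast; ring
      simp only [map_intCast, this]
      rw [Finset.sum_comm, Finset.mul_sum]
      refine Finset.sum_congr rfl fun j _ => ?_
      rw [← Finset.sum_smul, ht]
      simp only [zsmul_eq_mul]; push_cast; ring

lemma step_aux {K : Type*} [CommRing K] (x : K) (c v v' : Fin 12 → ℤ)
    (hx : x ^ 12 = - ∑ i : Fin 12, (c i : K) * x ^ (i : ℕ))
    (h0 : v' 0 = - c 0 * v (Fin.last 11))
    (hs : ∀ i : Fin 11, v' i.succ = v i.castSucc - c i.succ * v (Fin.last 11)) :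
    x * ∑ i : Fin 12, (v i : K) * x ^ (i : ℕ) = ∑ i : Fin 12, (v' i : K) * x ^ (i : ℕ) := by
  rw [Fin.sum_univ_succ] at hx
  rw [Fin.sum_univ_castSucc, Fin.sum_univ_succ (fun i : Fin 12 => (v' i : K) * x ^ (i : ℕ))]
  have e : ∑ i : Fin 11, ((v' i.succ : ℤ) : K) * x ^ ((i.succ : Fin 12) : ℕ) =
      x * ∑ i : Fin 11, ((v i.castSucc : ℤ) : K) * x ^ ((i.castSucc : Fin 12) : ℕ) -
      (v (Fin.last 11) : K) * ∑ i : Fin 11, ((c i.succ : ℤ) : K) * x ^ ((i.succ : Fin 12) : ℕ) := by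
    rw [Finset.mul_sum, Finset.mul_sum, ← Finset.sum_sub_distrib]
    refine Finset.sum_congr rfl fun i _ => ?_
    rw [hs]; push_cast
    simp only [Fin.val_succ, Fin.val_castSucc]; ring
  rw [e, h0]
  generalize hvl : v (Fin.last 11) = vl at *
  push_cast
  have e11 : ((Fin.last 11 : Fin 12) : ℕ) = 11 := rfl
  simp only [Fin.val_zero, pow_zero, mul_one, Fin.coe_ofNat_eq_mod, Nat.reduceMod] at hx ⊢
  linear_combination (vl : K) * hx

lemma norm_det12 {K : Type*} [Field K] [NumberField K] (x z : K) (hK : Module.finrank ℚ K = 12)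
    (hd : (minpoly ℚ x).natDegree = 12) (c : Fin 12 → ℤ)
    (hx : x ^ 12 = - ∑ i : Fin 12, (c i : K) * x ^ (i : ℕ)) (M : Matrix (Fin 12) (Fin 12) ℤ)
    (hz : z = ∑ i : Fin 12, (M 0 i : K) * x ^ (i : ℕ))
    (hM : ∀ j : Fin 11, M j.succ 0 = - c 0 * M j.castSucc (Fin.last 11) ∧
      ∀ i : Fin 11, M j.succ i.succ = M j.castSucc i.castSucc - c i.succ * M j.castSucc (Fin.last 11)) :
    Algebra.norm ℚ z = (M.det : ℚ) := by
  have hcol : ∀ j : Fin 12, z * x ^ (j : ℕ) = ∑ i : Fin 12, (M j i : K) * x ^ (i : ℕ) := by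
    intro j
    induction j using Fin.induction with
    | zero => simpa using hz
    | succ j ih =>
      rw [← step_aux x c (M j.castSucc) (M j.succ) hx (hM j).1 (hM j).2, ← ih]
      simp only [Fin.val_succ, Fin.val_castSucc]; ring
  obtain ⟨pb, hpb⟩ := exists_pb x (by rw [hd, hK])
  have hdim : pb.dim = 12 := by rw [← pb.finrank, hK]
  let b := pb.basis.reindex (finCongr hdim)
  have hb : ∀ i, b i = x ^ (i : ℕ) := by
    intro i; simp [b, hpb]
  rw [Algebra.norm_eq_matrix_det b]
  have : Algebra.leftMulMatrix b z = ((Int.castRingHom ℚ).mapMatrix M).transpose := by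
    ext i j
    rw [Algebra.leftMulMatrix_eq_repr_mul, hb, hcol]
    have : ∑ i : Fin 12, (M j i : K) * x ^ (i : ℕ) = ∑ i : Fin 12, (M j i : ℚ) • b i := by
      refine Finset.sum_congr rfl fun i _ => ?_
      rw [hb, Algebra.smul_def]; simp
    rw [this, Module.Basis.repr_sum_self]
    simp
  rw [this, Matrix.det_transpose, ← RingHom.map_det]
  simp

lemma det_cert {n : ℕ} {R : Type*} [CommRing R] [IsDomain R] (A M : Matrix (Fin n) (Fin n) R) (a d : R)
    (ha : a ≠ 0)
    (hA : ∀ i j : Fin n, i < j → (A * (1 : Matrix (Fin n) (Fin n) R)) i j = 0) (hU : ∀ i j, j < i → (A * M) i j = 0)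
    (h1 : ∏ i, A i i = a) (h2 : ∏ i, (A * M) i i = a * d) : M.det = d := by
  have e1 : A.det = a := by
    rw [← h1]; exact Matrix.det_of_isLowerTriangular A (fun i j h => by simpa using hA i j h)
  have e2 : (A * M).det = a * d := by
    rw [← h2]; exact Matrix.det_of_isUpperTriangular (fun i j h => hU i j h)
  rw [Matrix.det_mul, e1] at e2
  exact mul_left_cancel₀ ha e2

def MH : Matrix (Fin 12) (Fin 12) ℤ := !![960, 640, -2820, 7660, -2800, -7200, -5320, 1760, 720, -160, -44, 12;
    4920, -10560, -3200, 8460, -15320, 3920, 7200, 3800, -880, -240, 32, 4;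
    1640, 1080, -11840, 560, 800, -13080, 8720, 10240, 2920, -1200, -176, 48;
    19680, -44440, -14280, 33280, -91360, 27680, 44520, 45200, -320, -920, -432, 16;
    6560, 4320, -49560, 760, 2640, -82400, 46880, 56680, 41680, -1600, -664, -368;
    -150880, 359840, 122080, -395480, 705480, -203440, -524000, -232800, 137640, 71120, -7488, -2136;
    -875760, 1899680, 1043360, -1885760, 3694960, -490680, -2766640, -2147360, 237120, 308520, 36944, -16032;
    -6573120, 14514960, 7029920, -14026720, 28815520, -5282960, -19729080, -14950960, 1379680, 1519680, 52008, -27184;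
    -11145440, 19523520, 23213840, -18523040, 38030640, 13592480, -37903760, -40388920, -8970480, 3554400, 1084736, -56728;
    -23258480, 43313440, 37676480, -30110480, 90111080, 6262960, -54481120, -81017040, -27908760, -4432240, 2646752, 857824;
    351707840, -846769520, -231190240, 844031040, -1672843440, 570492520, 1035651760, 597465120, -269738320, -96534680, 9292944, 6078048;
    2491999680, -5483218240, -2791744880, 5482174880, -10795430880, 1730863440, 7864150120, 5654968240, -739705440, -755982160, 714088, 33605136]
def AH : Matrix (Fin 12) (Fin 12) ℤ := !![1, 0, 0, 0, 0, 0, 0, 0, 0, 0, 0, 0;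
    -41, 8, 0, 0, 0, 0, 0, 0, 0, 0, 0, 0;
    -14145, -8, 8304, 0, 0, 0, 0, 0, 0, 0, 0, 0;
    275930, -714345, -79833, 171779, 0, 0, 0, 0, 0, 0, 0, 0;
    219464390, 1475165980, -6222480160, -354626788, 1481009179, 0, 0, 0, 0, 0, 0, 0;
    8618509729990, 7483145008560, -113479004530420, -174603684240, 26686968804183, 202913508766, 0, 0, 0, 0, 0, 0;
    -8399960751649650, 16142129299954960, 8541024017455140, 9175613683161320, 6883099318721715, -3998607459292818, 1044123613200364, 0, 0, 0, 0, 0;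
    1988552681302603570890, -4928075121599079376200, -1137105483885852612580, 4361406054659957609940, -897786771550134938435, 110391271296960840810, -572582743461518743608, 82233436528942650434, 0, 0, 0, 0;
    -72346082050084487639806150, 70473975208653161986451360, 218936928877897218911645600, -22811000209883312541944420, 337744284511403814839509235, 106003535960955886858806360, -54801371934212239699812560, 1259598103525228581943508, 2343789459900684554049241, 0, 0, 0;
    271054281104094076550990793830, -678787493863424996394422267100, -47921228037364418425125474240, 739526011772383745380375894900, -1856069404670808528120266671115, 506372312494816121216532464030, 440604162264139959745321035640, -62869730530911354036689379860, -15951080023517848268679441593, 5502817736761402662049693694, 0, 0;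
    -4229705722285139717494473256546750, 19321202593420181265310167309490380, -22352463638573354389863503884017600, -10772715519687080519611259746035140, 54735498450335002743790258766826775, -69441186529189299777700113342850390, 12134602628023711589684166805295080, 15874038357496940204484188885677540, -1949692553677666078299952878448835, -621003110803660185489661418700598, 193673541616509320951207819697984, 0;
    1311748969970456255915316387518477607770, 1241494169542305512495380365203191362300, -11074373913290175080695061280859101883080, 1776033918326819528821236805545505427800, 2769988256030693726951433201032264962315, -27677554643998480654516969816485978385390, 8988133769493828445587789060421616108980, 7070657680012156794854368548322779905110, -888725718671934719239371897448906091375, -260313817573258597986641362572039527230, 80162323922280746956382912546568087036, 2398054231529947201943925375349533882]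
def cH : Fin 12 → ℤ := ![-410, 960, 320, -940, 1915, -560, -1200, -760, 220, 80, -16, -4]

set_option maxRecDepth 100000 in
lemma MH_det : MH.det = 97509614873605121187191076313055239237489722916864000000000000 := by
  apply det_cert AH MH (1763800600064311885068409870212099858081278746851355546805349822121261803016648314694131788835841323833632336078525760365309592874448003473966882704845200985328694836682374705204320272384) _
  · decide
  · decide +kernel
  · decide +kernel
  · decide +kernel
  · decide +kernel

def MF : Matrix (Fin 12) (Fin 12) ℤ := !![-36096, -41088, 67200, 89280, -82560, -4032, 28224, 36000, 13680, 2040, 264, 12;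
    129792, 397056, 205440, -201600, -178560, 115584, 4032, -20160, -18000, -4560, -408, -24;
    -259584, -736512, -96000, 743040, 334080, -574848, 99456, 100800, 87840, 18480, 336, 168;
    1817088, 5804544, 2714880, -3859200, -3006720, 3108096, -461952, -577920, -655200, -167520, -15792, -3696;
    -39975936, -131593728, -70126080, 85505280, 78635520, -64035072, 624384, 14440320, 16054080, 4962720, 586464, 72912;
    788616192, 2591855616, 1366310400, -1703354880, -1541890560, 1282558464, -15038208, -293356800, -313663680, -94772160, -9911328, -1163424;
    -12583593984, -41206336512, -21309527040, 27427008000, 24264268800, -20752347648, 500737536, 4675887360, 4942051200, 1454740800, 142566336, 18010848;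
    194805331968, 637535975424, 328808524800, -424752522240, -374575119360, 321659390976, -8649057792, -72119001600, -76372928640, -22434437760, -2219472192, -289694016;
    -3133330477056, -10261989869568, -5313937889280, 6817954483200, 6041217914880, -5158002711552, 126985012224, 1159397214720, 1231504070400, 363961975680, 36663141504, 4733184192;
    51194120220672, 167715686117376, 86976546170880, -111337263790080, -98826716682240, 84195555293184, -1977302934528, -18957213649920, -20139931649280, -5962935901440, -601607599488, -76933279104;
    -832110346788864, -2725789522317312, -1412801599795200, 1810281998100480, 1605813525811200, -1369149021247488, 32496391735296, 308217678412800, 327242542318080, 96798652588800, 9731453035776, 1244791099008;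
    13463660526870528, 44099869163003904, 22847198815703040, -29296122217574400, -25973455331758080, 22159804152631296, -532649402714112, -4986501319464960, -5293342267123200, -1564839928174080, -157138731608832, -20143533340416]
def AF : Matrix (Fin 12) (Fin 12) ℤ := !![1, 0, 0, 0, 0, 0, 0, 0, 0, 0, 0, 0;
    169, 47, 0, 0, 0, 0, 0, 0, 0, 0, 0, 0;
    -5070, 10796, 6103, 0, 0, 0, 0, 0, 0, 0, 0, 0;
    -993382, -1673526, 478371, 168143, 0, 0, 0, 0, 0, 0, 0, 0;
    -1444516684, -2757912864, 1123706652, 585237080, 11654943, 0, 0, 0, 0, 0, 0, 0;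
    75741055156, 195991066712, 1559495228, -21003390928, 18093404863, 937295618, 0, 0, 0, 0, 0, 0;
    8530268054776, 21792808293728, -316370083500, -2096019495840, 2159606068230, 123677721976, 794373733, 0, 0, 0, 0, 0;
    -13751587074680, -48821448440056, -49623167526708, -22703625690420, 14445532938810, 2920354150570, 779293968739, 41656803267, 0, 0, 0, 0;
    234531486457424, 847412019489088, 880619784855488, 374108181102592, -256525609139616, -41579033257840, -12295568275528, -513650538496, 10429235711, 0, 0, 0;
    -41804487332192, -153931180234896, -112721417866944, 49455864009792, -7355974285888, -27036054888512, 33153322088864, 3926074225256, 732854068382, 38472544957, 0, 0;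
    -3733591264, -16255458720, -19642749392, 2897795648, 16071099392, -9145413536, -2742537680, 6008066048, 755318078, 134454042, 6866473, 0;
    31528640, 96172256, 10265920, -151622352, -89684672, 98532672, -14901376, -27871440, 7131988, 761858, 203332, 11713]
def cF : Fin 12 → ℤ := ![-10816, -36096, -20544, 22400, 22320, -16512, -672, 4032, 4500, 1520, 204, 24]

set_option maxRecDepth 100000 in
lemma MF_det : MF.det = 1246937445336862705036968938341123320411288204056985600000000000000000000000000000000 := by
  apply det_cert AF MF (562629932705352913678726316934803991186775037714468053889990198328491583412986) _
  · decide
  · decide +kernel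
  · decide +kernel
  · decide +kernel
  · decide +kernel

lemma cast_root {K : Type*} [Field K] (x : K) (p : ℤ[X]) (c : Fin 12 → ℤ)
    (hp : p = X ^ 12 + ∑ i : Fin 12, C (c i) * X ^ (i : ℕ)) (hx : aeval x p = 0) :
    x ^ 12 = - ∑ i : Fin 12, (c i : K) * x ^ (i : ℕ) := by
  rw [hp] at hx
  simp only [map_add, map_pow, aeval_X, map_sum, map_mul, eq_intCast, map_intCast] at hx
  linear_combination hx

open NumberField in
lemma norm_val {K : Type*} [Field K] [NumberField K] (hK : Module.finrank ℚ K = 12) (θ : K)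
    (h : ℤ[X]) (hm : h.Monic) (hd : h.natDegree = 12)
    (hmin : minpoly ℚ θ = h.map (Int.castRingHom ℚ)) (c : Fin 12 → ℤ) (M : Matrix (Fin 12) (Fin 12) ℤ)
    (hp : h = X ^ 12 + ∑ i : Fin 12, C (c i) * X ^ (i : ℕ))
    (hdv : derivative h = ∑ i : Fin 12, C (M 0 i) * X ^ (i : ℕ))
    (hM : ∀ j : Fin 11, M j.succ 0 = - c 0 * M j.castSucc (Fin.last 11) ∧
      ∀ i : Fin 11, M j.succ i.succ = M j.castSucc i.castSucc - c i.succ * M j.castSucc (Fin.last 11)) :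
    Algebra.norm ℚ (aeval θ (derivative (h.map (Int.castRingHom ℚ)))) = (M.det : ℚ) := by
  have hx : aeval θ h = 0 := by
    have := minpoly.aeval ℚ θ
    rw [hmin, show Int.castRingHom ℚ = algebraMap ℤ ℚ from rfl, Polynomial.aeval_map_algebraMap] at this
    exact this
  apply norm_det12 θ _ hK (by rw [hmin, hm.natDegree_map, hd]) c (cast_root θ h c hp hx) M _ hM
  rw [derivative_map, show Int.castRingHom ℚ = algebraMap ℤ ℚ from rfl, Polynomial.aeval_map_algebraMap,
    hdv]
  simp only [map_pow, aeval_X, map_sum, map_mul, eq_intCast, map_intCast]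

lemma hZ_form : hZ = X ^ 12 + ∑ i : Fin 12, C (cH i) * X ^ (i : ℕ) := by
  simp only [Fin.sum_univ_succ, cH, hZ]
  simp
  ring

lemma fZ_form : fZ = X ^ 12 + ∑ i : Fin 12, C (cF i) * X ^ (i : ℕ) := by
  simp only [Fin.sum_univ_succ, cF, fZ]
  simp
  ring

lemma hZ_deriv : derivative hZ = ∑ i : Fin 12, C (MH 0 i) * X ^ (i : ℕ) := by
  simp only [Fin.sum_univ_succ, MH, hZ]
  simp
  ring

lemma fZ_deriv : derivative fZ = ∑ i : Fin 12, C (MF 0 i) * X ^ (i : ℕ) := by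
  simp only [Fin.sum_univ_succ, MF, fZ]
  simp
  ring

lemma isInt_aux {K : Type*} [Field K] [NumberField K] (θ : K)
    (h : ℤ[X]) (hm : h.Monic) (hmin : aeval θ (h.map (Int.castRingHom ℚ)) = 0) : IsIntegral ℤ θ := by
  rw [show Int.castRingHom ℚ = algebraMap ℤ ℚ from rfl, Polynomial.aeval_map_algebraMap] at hmin
  exact ⟨h, hm, hmin⟩

open NumberField in
lemma discr_eq {K : Type*} [Field K] [NumberField K] (hK : Module.finrank ℚ K = 12) (x : K)
    (hx : aeval x f2 = 0) : discr K = 2 ^ 38 * 5 ^ 12 := by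
  have hx' := hx
  rw [aeval_f2] at hx'
  obtain ⟨y, hy⟩ := theta_root x hx'
  rw [← aeval_hZ] at hy
  have hmx : minpoly ℚ x = fZ.map (Int.castRingHom ℚ) := by rw [fZ_map]; exact f2_minpoly x hx
  have hmy := hQ_minpoly y hy
  obtain ⟨xO, rfl⟩ : ∃ z : 𝓞 K, (z : K) = x :=
    ⟨⟨x, isInt_aux x fZ fZ_monic (by rw [fZ_map]; exact hx)⟩, rfl⟩
  obtain ⟨θ, rfl⟩ : ∃ z : 𝓞 K, (z : K) = y := ⟨⟨y, isInt_aux y hZ hZ_monic hy⟩, rfl⟩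
  obtain ⟨PF, hPF, -⟩ := disc_index fZ fZ_monic fZ_deg hK xO hmx
  obtain ⟨PH, hPH, hPH2⟩ := disc_index hZ hZ_monic hZ_deg hK θ hmy
  rw [norm_val hK _ fZ fZ_monic fZ_deg hmx cF MF fZ_form fZ_deriv (by decide +kernel), MF_det] at hPF
  rw [norm_val hK _ hZ hZ_monic hZ_deg hmy cH MH hZ_form hZ_deriv (by decide +kernel), MH_det] at hPH
  have hF : (1246937445336862705036968938341123320411288204056985600000000000000000000000000000000 : ℤ)
    = PF.det ^ 2 * discr K := by exact_mod_cast hPF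
  have hH : (97509614873605121187191076313055239237489722916864000000000000 : ℤ)
    = PH.det ^ 2 * discr K := by exact_mod_cast hPH
  have hp2 : Fact (Nat.Prime 2) := ⟨by norm_num⟩
  have hp5 : Fact (Nat.Prime 5) := ⟨by norm_num⟩
  have n2 : ¬ (2 : ℤ) ∣ PH.det := by
    intro h
    obtain ⟨q, w, h1, h2, h3⟩ := hPH2 2 h
    refine h2 (pmax 2 hZ hZ_monic hZ_deg hK θ hmy ?_ ?_ q h1 w h3)
    · rw [hZ_map2]
      exact ((Splits.X_sub_C _).pow _).mul ((Splits.X_sub_C _).pow _)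
    · intro c
      fin_cases c <;> simp [hZ, ZMod.val] <;> decide
  have n5 : ¬ (5 : ℤ) ∣ PH.det := by
    intro h
    obtain ⟨q, w, h1, h2, h3⟩ := hPH2 5 h
    refine h2 (pmax 5 hZ hZ_monic hZ_deg hK θ hmy ?_ ?_ q h1 w h3)
    · rw [hZ_map5]
      exact ((Splits.X_sub_C _).pow _).mul ((Splits.X_sub_C _).pow _)
    · intro c
      fin_cases c <;> simp [hZ, ZMod.val] <;> decide
  generalize discr K = D at hF hH ⊢
  generalize PH.det = a at hH n2 n5
  generalize PF.det = b at hF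
  have hDpos : 0 < D := by
    have : 0 < b ^ 2 * D := by rw [← hF]; norm_num
    exact (pos_iff_pos_of_mul_pos this).1 (by
      rcases (sq_nonneg b).lt_or_eq with h | h
      · exact h
      · rw [← h] at this; simp at this)
  have c2 : IsCoprime (2 : ℤ) a := (Int.prime_two.coprime_iff_not_dvd).2 n2
  have c5 : IsCoprime (5 : ℤ) a := ((Nat.prime_iff_prime_int.1 hp5.out).coprime_iff_not_dvd).2 n5
  have hc : IsCoprime ((2 : ℤ) ^ 38 * 5 ^ 12) (a ^ 2) :=
    IsCoprime.mul_left (c2.pow) (c5.pow)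
  obtain ⟨e, rfl⟩ : (2 : ℤ) ^ 38 * 5 ^ 12 ∣ D := by
    apply hc.dvd_of_dvd_mul_left
    rw [← hH]; norm_num
  have he : 0 < e := by
    by_contra hcon
    nlinarith
  have hm : (1453006489181594866323338096038330185972001 : ℤ) = a ^ 2 * e := by
    have : (2 : ℤ) ^ 38 * 5 ^ 12 ≠ 0 := by norm_num
    apply mul_left_cancel₀ this
    rw [show a ^ 2 * (2 ^ 38 * 5 ^ 12 * e) = 2 ^ 38 * 5 ^ 12 * (a ^ 2 * e) by ring] at hH
    rw [← hH]; norm_num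
  have ce : IsCoprime e 30 := by
    have : IsCoprime (1453006489181594866323338096038330185972001 : ℤ) 30 := by
      rw [Int.isCoprime_iff_gcd_eq_one]; norm_num
    rw [hm] at this
    exact this.of_mul_left_right
  have ce2 : IsCoprime e (30 ^ 148) := ce.pow_right
  have hd : e ∣ 30 ^ 148 := by
    refine Dvd.dvd.trans ⟨b ^ 2 * (2 ^ 38 * 5 ^ 12), ?_⟩ (show
     (1246937445336862705036968938341123320411288204056985600000000000000000000000000000000 : ℤ) ∣ 30 ^ 148 by norm_num)
    rw [hF]; ring
  have hu : IsUnit e := ce2.isUnit_of_dvd' dvd_rfl hd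
  rcases Int.isUnit_iff.1 hu with h | h
  · rw [h]; norm_num
  · omega

namespace Cub
noncomputable def p10 {F : Type*} [Field F] (u : F) : F := u^10 - 40*u^7 + 32*u^5 + 810*u^2 - 1944
noncomputable def w {F : Type*} [Field F] (u r : F) : F := (-126943848 - 136544832*u + 28551312*u^2 + 36167328*u^3 + 15402052*u^4 + 11016072*u^5 + 5266648*u^6 - 555768*u^7 - 295992*u^8 - 161728*u^9 - 39281112*r - 40781232*r*u + 9897264*r*u^2 + 12078696*r*u^3 + 5150052*r*u^4 + 3746928*r*u^5 + 1723068*r*u^6 - 188496*r*u^7 - 101514*r*u^8 - 53388*r*u^9)/1212975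
noncomputable def m1 {F : Type*} [Field F] (u r : F) : F := (19010376 - 68272416*u + 14275656*u^2 + 18083664*u^3 + 7701026*u^4 + 5508036*u^5 + 2633324*u^6 - 277884*u^7 - 147996*u^8 - 80864*u^9 + 4618944*r - 20390616*r*u + 4948632*r*u^2 + 6039348*r*u^3 + 2575026*r*u^4 + 1873464*r*u^5 + 861534*r*u^6 - 94248*r*u^7 - 50757*r*u^8 - 26694*r*u^9)/4851900
noncomputable def m0 {F : Type*} [Field F] (u r : F) : F := (-75926808 - 97742592*u + 26977932*u^2 + 16986048*u^3 + 13082002*u^4 + 8018862*u^5 + 5859988*u^6 - 451998*u^7 - 214197*u^8 - 160078*u^9 - 23490648*r - 31599612*r*u + 8611974*r*u^2 + 5278482*r*u^3 + 4175989*r*u^4 + 2496672*r*u^5 + 1841938*r*u^6 - 142776*r*u^7 - 66888*r*u^8 - 50251*r*u^9)/2425950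
noncomputable def n1 {F : Type*} [Field F] (u r : F) : F := (161372872686528 + 741491230200552*u - 104052638255832*u^2 + 137083267769952*u^3 + 103574848140988*u^4 + 47216346952458*u^5 - 15940836595028*u^6 - 2822085909702*u^7 - 1192227872853*u^8 + 318746983118*u^9 + 135150517240848*r + 304794809044884*r*u - 25975898240418*r*u^2 + 38206762451634*r*u^3 + 22110077995663*r*u^4 + 26784507018648*r*u^5 - 12742918957166*r*u^6 - 442726548588*r*u^7 - 663491655381*r*u^8 + 283276423043*r*u^9)/728358014241900
noncomputable def n0 {F : Type*} [Field F] (u r : F) : F := (-780635277949032 + 748780979905152*u + 55562442925248*u^2 + 175433505481752*u^3 + 34290180530018*u^4 + 76096383441648*u^5 - 15529240623628*u^6 - 618298979472*u^7 - 1800618053478*u^8 + 282656306248*u^9 - 225637428044448*r + 177448295354400*r*u + 35038115687484*r*u^2 + 52807026585936*r*u^3 + 16720492453840*r*u^4 + 21755511200892*r*u^5 - 908800730810*r*u^6 - 422055147276*r*u^7 - 534055898019*r*u^8 - 8591994880*r*u^9)/242786004747300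
noncomputable def y5 {F : Type*} [Field F] (u r : F) : F := (-4977706608 - 2513460672*u + 312851952*u^2 + 421612608*u^3 + 242116012*u^4 + 242741712*u^5 + 130338208*u^6 - 8872128*u^7 - 6231612*u^8 - 3610168*u^9 - 1561523184*r - 791628768*r*u + 97419600*r*u^2 + 132606048*r*u^3 + 76294504*r*u^4 + 76270656*r*u^5 + 41027572*r*u^6 - 2794320*r*u^7 - 1957602*r*u^8 - 1136176*r*u^9)/1212975
theorem id3 {F : Type*} [Field F] [CharZero F] (u r : F) (hr : r^2 = 10) (hu : p10 u = 0) :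
    w u r*n1 u r/2 = 2*m0 u r + 2*(6+2*r)*m1 u r - (800+256*r) := by
  simp only [w, n1, m0, m1, p10] at *
  linear_combination ((-2006225394010793061696 + 2036508921371417404176*u - 2880112809428545059000*u^2 - 765002218786494248808*u^3 - 342873871936993138356*u^4 - 423735111393215968872*u^5 + 12449683658146172772*u^6 + 300942231421768063976*u^7 + 76092262128611328990*u^8 + 24979311167999870668*u^9 + 4754354850623705064*u^10 - 2624195233319146654*u^11 - 5490704106369154003*u^12 - 547906856443987716*u^13 - 22459880100925576*u^14 + 223071993818515590*u^15 + 6265584040408275*u^16 + 1110994948115621*u^17 - 2520593612236614*u^18)/294493354108356217500)*hr + ((-334422562392726612192 - 114910473759137802936*u - 47284290094584506196*u^2 - 15508138361886557552*u^3 + 570236463123530100*u^4 + 5513803605662081488*u^5 + 504042945828381054*u^6 + 82564884640322094*u^7 - 101392964409952372*u^8 - 106786876044982061520*r - 36456193481571156024*r*u - 15177799254223391628*r*u^2 - 4904264843420622584*r*u^3 + 135861576181333530*r*u^4 + 1725419372322892450*r*u^5 + 161082170864985141*r*u^6 + 27375501931875012*r*u^7 - 31415496640301044*r*u^8)/8834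80062325068652500)*hu
theorem id4 {F : Type*} [Field F] [CharZero F] (u r : F) (hr : r^2 = 10) (hu : p10 u = 0) :
    w u r/4 = 2*m1 u r + (6+2*r)^2 - (110+34*r) := by
  simp only [w, m1, p10] at *
  linear_combination ((-4))*hr + (0)*hu
theorem idy {F : Type*} [Field F] [CharZero F] (u r : F) (hr : r^2 = 10) (hu : p10 u = 0) :
    w u r*n0 u r = y5 u r := by
  simp only [w, n0, y5, p10] at *
  linear_combination ((211030692438235782528 + 53128712784254145408*u - 258240224787576909840*u^2 - 106484988678608229984*u^3 - 35291765010839353056*u^4 - 12432913610405309280*u^5 + 9722732735097476688*u^6 + 29106048898135172576*u^7 + 14899510852652522172*u^8 + 6192227017355254168*u^9 + 1729260726080188776*u^10 + 356872830245891132*u^11 - 348071045048902858*u^12 - 135771553556976924*u^13 - 46239993853437376*u^14 + 4219675446575184*u^15 + 1865866364313627*u^16 + 699628191706826*u^17 + 10921652920320*u^18)/7011746526389433750)*hr + ((-179558543859569608896 - 82829952160003060488*u - 34178120807184145188*u^2 - 10876019502089579936*u^3 - 3275350781050570140*u^4 + 1327777909047913684*u^5 + 314884334809498167*u^6 + 125347547917699722*u^7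 - 10281586217585536*u^8 - 56381620411097660988*r - 26093410486106013936*r*u - 10732979721090006774*r*u^2 - 3419538856607625376*r*u^3 - 1020320543075017770*r*u^4 + 423428631535671422*r*u^5 + 98406916982463609*r*u^6 + 39088194597490446*r*u^7 - 3425222182503896*r*u^8)/73623338527089054375)*hu
theorem id2 {F : Type*} [Field F] [CharZero F] (u r : F) (hr : r^2 = 10) (hu : p10 u = 0) :
    (4*m0 u r + 4*(6+2*r)*m1 u r - 2*(800+256*r))*n1 u r/4 + y5 u r/2 = m1 u r^2 + 2*(6+2*r)*m0 u r - (2620+824*r) := by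
  simp only [n1, m0, m1, y5, p10] at *
  linear_combination ((17921675444448428119296 - 4810854126415046242176*u - 73796121597148004362464*u^2 + 8510017608856930322880*u^3 + 4172686883144106326136*u^4 - 5503968964396968054768*u^5 + 2150358236456732964888*u^6 + 5273375878370355154552*u^7 - 581776080319775263714*u^8 - 438990611981229843208*u^9 - 249833736258727408844*u^10 - 126780361951703078576*u^11 - 100796111029311213624*u^12 + 11417807508293032652*u^13 + 7532443572558772756*u^14 + 6006940343047694120*u^15 - 218262477679247415*u^16 - 101085558239280740*u^17 - 81213708652036654*u^18 + 416168447137674283008*r - 898648096526998933248*r*u - 3777416636610089044800*r*u^2 + 2020451875954481705184*r*u^3 + 922199096870713281888*r*u^4 + 495417288421953460656*r*u^5 + 237144934649967343944*r*u^6 + 548960055622375343152*r*u^7 + 116807695228828332780*r*u^8 + 41578192704425327936*r*u^9 + 9508709701247410128*r*u^10 - 5248390466638293308*r*u^11 - 10981408212738308006*r*u^12 - 1095813712887975432*r*u^13 - 44919760201851152*r*u^14 + 446143987637031180*r*u^15 + 12531168080816550*r*u^16 + 2221989896231242*r*u^17 - 5041187224473228*r*u^18)/1177973416433424870000)*hr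 + ((-449990423982719106624 + 420805323695163707208*u + 228042096804129737418*u^2 + 87861401566985059276*u^3 + 48690698971228140030*u^4 + 28298583210514160056*u^5 - 3389969276729810982*u^6 - 1521274560080804682*u^7 - 918682797547378459*u^8 - 142981803379124703432*r + 132531958878771079296*r*u + 72022254032923369602*r*u^2 + 27694843677373399444*r*u^3 + 15392244493958191845*r*u^4 + 8957490092558011738*r*u^5 - 1068508678678350579*r*u^6 - 480194527169808888*r*u^7 - 290522802755514346*r*u^8)/883480062325068652500)*hu
theorem id1 {F : Type*} [Field F] [CharZero F] (u r : F) (hr : r^2 = 10) (hu : p10 u = 0) :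
    (4*m0 u r + 4*(6+2*r)*m1 u r - 2*(800+256*r))*n0 u r/2 = 2*m1 u r*m0 u r - (2576+816*r) := by
  simp only [n0, m0, m1, p10] at *
  linear_combination ((23257750813401418716672 - 4796214706787990338944*u - 31644289902547536257952*u^2 - 1016578143035754032736*u^3 + 1650932354983555075176*u^4 + 658466085468338993520*u^5 + 1313349307691007829704*u^6 + 2226685296951367587448*u^7 + 72250805116034854858*u^8 - 79891844672669203228*u^9 - 97056704743816157296*u^10 - 33654246791995255640*u^11 - 33144755891369572918*u^12 + 3903323399430251344*u^13 + 1625377915750651696*u^14 + 1823226299644771756*u^15 - 75022338440244063*u^16 - 22437034524517418*u^17 - 24284480165916650*u^18 - 347402214813778274304*r + 1806836629873134617856*r*u - 1524345851006199002880*r*u^2 - 318370900263086145888*r*u^3 - 111832092847898311392*r*u^4 + 88895546053175993040*r*u^5 + 60710112035987271816*r*u^6 + 200329393338498834032*r*u^7 + 99977932949237011704*r*u^8 + 43276109954889659176*r*u^9 + 12104825082561321432*r*u^10 + 2498109811721237924*r*u^11 - 2436497315342320006*r*u^12 - 950400874898838468*r*u^13 - 323679956974061632*r*u^14 + 29537728126026288*r*u^15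 + 13061064550195389*r*u^16 + 4897397341947782*r*u^17 + 76451570442240*r*u^18)/98164451369452072500)*hr + ((-295889606565652123056 + 104791467016347992712*u + 81275760527873859942*u^2 + 44906372313312007744*u^3 + 16437225369611152860*u^4 + 11609277914343328774*u^5 - 1705271000569269858*u^6 - 546574327160047998*u^7 - 372522144352890631*u^8 - 93631860194541996600*r + 33168422016238113360*r*u + 25690551534979100508*r*u^2 + 14206810897143231848*r*u^3 + 5196684992599668405*r*u^4 + 3670168474739174660*r*u^5 - 539337298109623335*r*u^6 - 172837616297970837*r*u^7 - 117775503924769397*r*u^8)/73623338527089054375)*hu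
theorem id0 {F : Type*} [Field F] [CharZero F] (u r : F) (hr : r^2 = 10) (hu : p10 u = 0) :
    y5 u r*n0 u r/4 = m0 u r^2 - (1032+328*r) := by
  simp only [n0, m0, y5, p10] at *
  linear_combination ((17277790991064213594240 - 28258604891668020210048*u - 24003413909760629928384*u^2 + 2553302366228688150816*u^3 + 2358044134507629470232*u^4 + 1215503261169229034208*u^5 + 2050569470189358936288*u^6 + 1775237378536309817496*u^7 - 492868955237437572850*u^8 - 264641052767089426896*u^9 - 190943016045769938044*u^10 - 54155591798349085440*u^11 - 41661845481263478496*u^12 + 9884467234307446592*u^13 + 3652688221024507572*u^14 + 2587744335809358788*u^15 - 158472362638349451*u^16 - 51566636731065576*u^17 - 35404872442333042*u^18)/84140958316673205000)*hr + ((-136455094033526921184 + 186303392528762833488*u + 90081921230319802038*u^2 + 60017615135188101416*u^3 + 20834419903675312830*u^4 + 15313794540834349496*u^5 - 2057876441666741277*u^6 - 675262059955211112*u^7 - 462756134279194619*u^8 - 43178210806149703908*r + 58878103206913869528*r*u + 28467252358608243042*r*u^2 + 18973537799937654056*r*u^3 + 6583202045381371545*r*u^4 + 4840417116671590652*r*u^5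 - 650487497667087222*r*u^6 - 213377595349723038*r*u^7 - 146262248661736034*r*u^8)/49082225684726036250)*hu
theorem idu {F : Type*} [Field F] [CharZero F] (u r : F) (hr : r^2 = 10) (hu : p10 u = 0) :
    ((14666240 + 4274944*r)*(1) + (-1864960 + 391552*r)*(m1 u r) + (715520 - 267392*r)*(m0 u r) + (123200 - 34928*r)*(y5 u r) + (14720 - 3776*r)*(m1 u r*m1 u r) + (48000 - 15168*r)*(m1 u r*m0 u r) + (38880 - 12312*r)*(m1 u r*y5 u r) + (228480 - 72096*r)*(m0 u r*m0 u r) + (18560 - 5888*r)*(m0 u r*y5 u r) + (7910 - 2501*r)*(y5 u r*y5 u r))/4147200 = u := by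
  simp only [m0, m1, y5, p10] at *
  linear_combination ((-1651204495216621728000 - 1729483144816432469760*u - 229868858347216128000*u^2 + 411716424273891370560*u^3 + 314850910498591827600*u^4 + 234653312724082437600*u^5 + 152083140255038330520*u^6 + 14576277332774749600*u^7 - 32784907680134071520*u^8 - 20802222698892173800*u^9 - 9252914806347824800*u^10 - 3651246302026524680*u^11 - 472421119221136300*u^12 + 511130155683033280*u^13 + 235699059744921100*u^14 + 59849205964774600*u^15 - 7432630340942460*u^16 - 3221760310516400*u^17 - 940360305154640*u^18 - 516154934989715266368*r - 541442886096050051904*r*u - 72740848784595829344*r*u^2 + 128713074351790495392*r*u^3 + 98797880392832912760*r*u^4 + 73545346654007195376*r*u^5 + 47628562927683237768*r*u^6 + 4593281123973524728*r*u^7 - 10265923257472913974*r*u^8 - 6523995346050897280*r*u^9 - 2902017329843112644*r*u^10 - 1143188876332078952*r*u^11 - 148069100798046612*r*u^12 + 160284015766730276*r*u^13 + 73802999938173460*r*u^14 + 18765978329272112*r*u^15 - 2330839834090749*r*u^16 - 1008922015946684*r*u^17 - 294849437079358*r*u^18)/508484165976000000)*hr + ((14820911377200 + 6435143470800*u + 2911995103800*u^2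 + 460083240160*u^3 - 572508058290*u^4 + 94130817280*u^5 - 27782003070*u^6 + 9403103760*u^7 - 4434800440*u^8 + 7845739410672*r + 5880116246544*r*u + 2406431643810*r*u^2 + 980979214088*r*u^3 + 307073196906*r*u^4 + 109881563276*r*u^5 - 33097509450*r*u^6 - 11060213316*r*u^7 - 4584960491*r*u^8)/15254524979280000)*hu
end Cub

noncomputable def gp {R : Type*} [CommRing R] (r : R) : R[X] :=
  X^6 + C (12+4*r) * X^5 + C (110+34*r) * X^4 + C (800+256*r) * X^3 + C (2620+824*r) * X^2 + C (2576+816*r) * X + C (1032+328*r)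

instance ns10 : Zsqrtd.Nonsquare 10 := ⟨fun n h => by
  rcases Nat.lt_or_ge n 4 with h1 | h1
  · interval_cases n <;> omega
  · nlinarith⟩

abbrev Z10 := Zsqrtd ((10 : ℕ) : ℤ)
def HK : Matrix (Fin 6) (Fin 6) Z10 := Matrix.of ![![⟨6, 0⟩, ⟨-12, -4⟩, ⟨84, 28⟩, ⟨-1848, -592⟩, ⟨36456, 11536⟩, ⟨-581712, -183920⟩], ![⟨-12, -4⟩, ⟨84, 28⟩, ⟨-1848, -592⟩, ⟨36456, 11536⟩, ⟨-581712, -183920⟩, ⟨9005424, 2847664⟩], ![⟨84, 28⟩, ⟨-1848, -592⟩, ⟨36456, 11536⟩, ⟨-581712, -183920⟩, ⟨9005424, 2847664⟩, ⟨-144847008, -45804608⟩], ![⟨-1848, -592⟩, ⟨36456, 11536⟩, ⟨-581712, -183920⟩, ⟨9005424, 2847664⟩, ⟨-144847008, -45804608⟩, ⟨2366592096, 748382592⟩], ![⟨36456, 11536⟩, ⟨-581712, -183920⟩, ⟨9005424, 2847664⟩, ⟨-144847008, -45804608⟩, ⟨2366592096, 748382592⟩, ⟨-38466639552, -12164220736⟩],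 ![⟨-581712, -183920⟩, ⟨9005424, 2847664⟩, ⟨-144847008, -45804608⟩, ⟨2366592096, 748382592⟩, ⟨-38466639552, -12164220736⟩, ⟨622395549504, 196818754240⟩]]
def HA : Matrix (Fin 6) (Fin 6) Z10 := Matrix.of ![![⟨1, 0⟩, ⟨0, 0⟩, ⟨0, 0⟩, ⟨0, 0⟩, ⟨0, 0⟩, ⟨0, 0⟩], ![⟨6, 2⟩, ⟨3, 0⟩, ⟨0, 0⟩, ⟨0, 0⟩, ⟨0, 0⟩, ⟨0, 0⟩], ![⟨2682, 846⟩, ⟨880, 216⟩, ⟨37, 0⟩, ⟨0, 0⟩, ⟨0, 0⟩, ⟨0, 0⟩], ![⟨4902876, 1564326⟩, ⟨1332290, 393094⟩, ⟨187892, 49063⟩, ⟨14733, 0⟩, ⟨0, 0⟩, ⟨0, 0⟩], ![⟨2362175876, 740121816⟩, ⟨1887202196, 606042540⟩, ⟨246278772, 74903052⟩, ⟨36033530, 11219508⟩, ⟨3403123, 0⟩, ⟨0, 0⟩], ![⟨2736132, 866728⟩, ⟨4387004, 1380076⟩, ⟨1417916, 451476⟩, ⟨198594, 60436⟩, ⟨22871,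 7028⟩, ⟨1846, 0⟩]]
lemma HK_det : HK.det = ⟨8623226880000, 2726903808000⟩^2 := by
  apply det_cert HA HK ⟨10273620295746054, 0⟩ _
  · decide +kernel
  · decide +kernel
  · decide +kernel
  · decide +kernel
  · decide +kernel

lemma coef6 {R : Type*} [CommRing R] {c0 c1 c2 c3 c4 c5 d0 d1 d2 d3 d4 d5 : R}
    (h : X^6 + C c5 * X^5 + C c4 * X^4 + C c3 * X^3 + C c2 * X^2 + C c1 * X + C c0 =
      X^6 + C d5 * X^5 + C d4 * X^4 + C d3 * X^3 + C d2 * X^2 + C d1 * X + C d0) :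
    c5 = d5 ∧ c4 = d4 ∧ c3 = d3 ∧ c2 = d2 ∧ c1 = d1 ∧ c0 = d0 := by
  have hc := fun k => congrArg (fun q => coeff q k) h
  refine ⟨?_, ?_, ?_, ?_, ?_, ?_⟩
  · simpa [coeff_X, coeff_C, coeff_X_pow, coeff_C_mul] using hc 5
  · simpa [coeff_X, coeff_C, coeff_X_pow, coeff_C_mul] using hc 4
  · simpa [coeff_X, coeff_C, coeff_X_pow, coeff_C_mul] using hc 3
  · simpa [coeff_X, coeff_C, coeff_X_pow, coeff_C_mul] using hc 2
  · simpa [coeff_X, coeff_C, coeff_X_pow, coeff_C_mul] using hc 1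
  · simpa [coeff_X, coeff_C, coeff_X_pow, coeff_C_mul] using hc 0

lemma gp_vieta {R : Type*} [CommRing R] (r a0 a1 a2 a3 a4 a5 : R)
    (h : (X - C a0) * (X - C a1) * (X - C a2) * (X - C a3) * (X - C a4) * (X - C a5) = gp r) :
    a0 + a1 + a2 + a3 + a4 + a5 = -(12+4*r) ∧
    a0*a1 + a0*a2 + a0*a3 + a0*a4 + a0*a5 + a1*a2 + a1*a3 + a1*a4 + a1*a5 + a2*a3 + a2*a4 + a2*a5 + a3*a4 + a3*a5 + a4*a5 = (110+34*r) ∧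
    a0*a1*a2 + a0*a1*a3 + a0*a1*a4 + a0*a1*a5 + a0*a2*a3 + a0*a2*a4 + a0*a2*a5 + a0*a3*a4 + a0*a3*a5 + a0*a4*a5 + a1*a2*a3 + a1*a2*a4 + a1*a2*a5 + a1*a3*a4 + a1*a3*a5 + a1*a4*a5 + a2*a3*a4 + a2*a3*a5 + a2*a4*a5 + a3*a4*a5 = -(800+256*r) ∧
    a0*a1*a2*a3 + a0*a1*a2*a4 + a0*a1*a2*a5 + a0*a1*a3*a4 + a0*a1*a3*a5 + a0*a1*a4*a5 + a0*a2*a3*a4 + a0*a2*a3*a5 + a0*a2*a4*a5 + a0*a3*a4*a5 + a1*a2*a3*a4 + a1*a2*a3*a5 + a1*a2*a4*a5 + a1*a3*a4*a5 + a2*a3*a4*a5 = (2620+824*r) ∧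
    a0*a1*a2*a3*a4 + a0*a1*a2*a3*a5 + a0*a1*a2*a4*a5 + a0*a1*a3*a4*a5 + a0*a2*a3*a4*a5 + a1*a2*a3*a4*a5 = -(2576+816*r) ∧
    a0*a1*a2*a3*a4*a5 = (1032+328*r) := by
  have e : (X - C a0) * (X - C a1) * (X - C a2) * (X - C a3) * (X - C a4) * (X - C a5) =
    X^6 + C (-(a0 + a1 + a2 + a3 + a4 + a5)) * X^5 + C ((a0*a1 + a0*a2 + a0*a3 + a0*a4 + a0*a5 + a1*a2 + a1*a3 + a1*a4 + a1*a5 + a2*a3 + a2*a4 + a2*a5 + a3*a4 + a3*a5 + a4*a5)) * X^4 + C (-(a0*a1*a2 + a0*a1*a3 + a0*a1*a4 + a0*a1*a5 + a0*a2*a3 + a0*a2*a4 + a0*a2*a5 + a0*a3*a4 + a0*a3*a5 + a0*a4*a5 + a1*a2*a3 + a1*a2*a4 + a1*a2*a5 + a1*a3*a4 + a1*a3*a5 + a1*a4*a5 + a2*a3*a4 + a2*a3*a5 + a2*a4*a5 + a3*a4*a5)) * X^3 + C ((a0*a1*a2*a3 + a0*a1*a2*a4 + a0*a1*a2*a5 +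 a0*a1*a3*a4 + a0*a1*a3*a5 + a0*a1*a4*a5 + a0*a2*a3*a4 + a0*a2*a3*a5 + a0*a2*a4*a5 + a0*a3*a4*a5 + a1*a2*a3*a4 + a1*a2*a3*a5 + a1*a2*a4*a5 + a1*a3*a4*a5 + a2*a3*a4*a5)) * X^2 + C (-(a0*a1*a2*a3*a4 + a0*a1*a2*a3*a5 + a0*a1*a2*a4*a5 + a0*a1*a3*a4*a5 + a0*a2*a3*a4*a5 + a1*a2*a3*a4*a5)) * X + C ((a0*a1*a2*a3*a4*a5)) := by
    simp only [map_add, map_mul, map_neg]; ring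
  obtain ⟨h5, h4, h3, h2, h1, h0⟩ := coef6 (e.symm.trans h)
  exact ⟨neg_eq_iff_eq_neg.mp h5, h4, neg_eq_iff_eq_neg.mp h3, h2, neg_eq_iff_eq_neg.mp h1, h0⟩

lemma gp_psum {R : Type*} [CommRing R] (r a0 a1 a2 a3 a4 a5 : R) (hr : r^2 = 10)
    (h : (X - C a0) * (X - C a1) * (X - C a2) * (X - C a3) * (X - C a4) * (X - C a5) = gp r)
    (hx : ∀ x ∈ ({a0, a1, a2, a3, a4, a5} : Set R), x^6 + (12+4*r) * x^5 + (110+34*r) * x^4 + (800+256*r) * x^3 + (2620+824*r) * x^2 + (2576+816*r) * x + (1032+328*r) = 0) :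
    (a0^1 + a1^1 + a2^1 + a3^1 + a4^1 + a5^1) = (-12 - 4*r) ∧
    (a0^2 + a1^2 + a2^2 + a3^2 + a4^2 + a5^2) = (84 + 28*r) ∧
    (a0^3 + a1^3 + a2^3 + a3^3 + a4^3 + a5^3) = (-1848 - 592*r) ∧
    (a0^4 + a1^4 + a2^4 + a3^4 + a4^4 + a5^4) = (36456 + 11536*r) ∧
    (a0^5 + a1^5 + a2^5 + a3^5 + a4^5 + a5^5) = (-581712 - 183920*r) ∧
    (a0^6 + a1^6 + a2^6 + a3^6 + a4^6 + a5^6) = (9005424 + 2847664*r) ∧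
    (a0^7 + a1^7 + a2^7 + a3^7 + a4^7 + a5^7) = (-144847008 - 45804608*r) ∧
    (a0^8 + a1^8 + a2^8 + a3^8 + a4^8 + a5^8) = (2366592096 + 748382592*r) ∧
    (a0^9 + a1^9 + a2^9 + a3^9 + a4^9 + a5^9) = (-38466639552 - 12164220736*r) ∧
    (a0^10 + a1^10 + a2^10 + a3^10 + a4^10 + a5^10) = (622395549504 + 196818754240*r) := by
  obtain ⟨e1, e2, e3, e4, e5, e6⟩ := gp_vieta r a0 a1 a2 a3 a4 a5 h
  have n1 : (a0^1 + a1^1 + a2^1 + a3^1 + a4^1 + a5^1) = (a0 + a1 + a2 + a3 + a4 + a5)*1 := by ring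
  rw [e1] at n1
  have p1 : (a0^1 + a1^1 + a2^1 + a3^1 + a4^1 + a5^1) = (-12 - 4*r) := by rw [n1]; linear_combination (0)*hr
  have n2 : (a0^2 + a1^2 + a2^2 + a3^2 + a4^2 + a5^2) = (a0 + a1 + a2 + a3 + a4 + a5)*(a0^1 + a1^1 + a2^1 + a3^1 + a4^1 + a5^1) - (a0*a1 + a0*a2 + a0*a3 + a0*a4 + a0*a5 + a1*a2 + a1*a3 + a1*a4 + a1*a5 + a2*a3 + a2*a4 + a2*a5 + a3*a4 + a3*a5 + a4*a5)*2 := by ring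
  rw [e1, e2, p1] at n2
  have p2 : (a0^2 + a1^2 + a2^2 + a3^2 + a4^2 + a5^2) = (84 + 28*r) := by rw [n2]; linear_combination (16)*hr
  have n3 : (a0^3 + a1^3 + a2^3 + a3^3 + a4^3 + a5^3) = (a0 + a1 + a2 + a3 + a4 + a5)*(a0^2 + a1^2 + a2^2 + a3^2 + a4^2 + a5^2) - (a0*a1 + a0*a2 + a0*a3 + a0*a4 + a0*a5 + a1*a2 + a1*a3 + a1*a4 + a1*a5 + a2*a3 + a2*a4 + a2*a5 + a3*a4 + a3*a5 + a4*a5)*(a0^1 + a1^1 + a2^1 + a3^1 + a4^1 + a5^1) + (a0*a1*a2 + a0*a1*a3 + a0*a1*a4 + a0*a1*a5 + a0*a2*a3 + a0*a2*a4 + a0*a2*a5 + a0*a3*a4 + a0*a3*a5 + a0*a4*a5 + a1*a2*a3 + a1*a2*a4 + a1*a2*a5 + a1*a3*a4 + a1*a3*a5 + a1*a4*a5 + a2*a3*a4 + a2*a3*a5 + a2*a4*a5 + a3*a4*a5)*3 := by ring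
  rw [e1, e2, e3, p1, p2] at n3
  have p3 : (a0^3 + a1^3 + a2^3 + a3^3 + a4^3 + a5^3) = (-1848 - 592*r) := by rw [n3]; linear_combination (24)*hr
  have n4 : (a0^4 + a1^4 + a2^4 + a3^4 + a4^4 + a5^4) = (a0 + a1 + a2 + a3 + a4 + a5)*(a0^3 + a1^3 + a2^3 + a3^3 + a4^3 + a5^3) - (a0*a1 + a0*a2 + a0*a3 + a0*a4 + a0*a5 + a1*a2 + a1*a3 + a1*a4 + a1*a5 + a2*a3 + a2*a4 + a2*a5 + a3*a4 + a3*a5 + a4*a5)*(a0^2 + a1^2 + a2^2 + a3^2 + a4^2 + a5^2) + (a0*a1*a2 + a0*a1*a3 + a0*a1*a4 + a0*a1*a5 + a0*a2*a3 + a0*a2*a4 + a0*a2*a5 + a0*a3*a4 + a0*a3*a5 + a0*a4*a5 + a1*a2*a3 + a1*a2*a4 + a1*a2*a5 + a1*a3*a4 + a1*a3*a5 + a1*a4*a5 + a2*a3*a4 + a2*a3*a5 + a2*a4*a5 + a3*a4*a5)*(a0^1 + a1^1 + a2^1 + a3^1 + a4^1 + a5^1) - (a0*a1*a2*a3 + a0*a1*a2*a4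 + a0*a1*a2*a5 + a0*a1*a3*a4 + a0*a1*a3*a5 + a0*a1*a4*a5 + a0*a2*a3*a4 + a0*a2*a3*a5 + a0*a2*a4*a5 + a0*a3*a4*a5 + a1*a2*a3*a4 + a1*a2*a3*a5 + a1*a2*a4*a5 + a1*a3*a4*a5 + a2*a3*a4*a5)*4 := by ring
  rw [e1, e2, e3, e4, p1, p2, p3] at n4
  have p4 : (a0^4 + a1^4 + a2^4 + a3^4 + a4^4 + a5^4) = (36456 + 11536*r) := by rw [n4]; linear_combination (2440)*hr
  have n5 : (a0^5 + a1^5 + a2^5 + a3^5 + a4^5 + a5^5) = (a0 + a1 + a2 + a3 + a4 + a5)*(a0^4 + a1^4 + a2^4 + a3^4 + a4^4 + a5^4) - (a0*a1 + a0*a2 + a0*a3 + a0*a4 + a0*a5 + a1*a2 + a1*a3 + a1*a4 + a1*a5 + a2*a3 + a2*a4 + a2*a5 + a3*a4 + a3*a5 + a4*a5)*(a0^3 + a1^3 + a2^3 + a3^3 + a4^3 + a5^3) + (a0*a1*a2 + a0*a1*a3 + a0*a1*a4 + a0*a1*a5 + a0*a2*a3 + a0*a2*a4 + a0*a2*a5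 + a0*a3*a4 + a0*a3*a5 + a0*a4*a5 + a1*a2*a3 + a1*a2*a4 + a1*a2*a5 + a1*a3*a4 + a1*a3*a5 + a1*a4*a5 + a2*a3*a4 + a2*a3*a5 + a2*a4*a5 + a3*a4*a5)*(a0^2 + a1^2 + a2^2 + a3^2 + a4^2 + a5^2) - (a0*a1*a2*a3 + a0*a1*a2*a4 + a0*a1*a2*a5 + a0*a1*a3*a4 + a0*a1*a3*a5 + a0*a1*a4*a5 + a0*a2*a3*a4 + a0*a2*a3*a5 + a0*a2*a4*a5 + a0*a3*a4*a5 + a1*a2*a3*a4 + a1*a2*a3*a5 + a1*a2*a4*a5 + a1*a3*a4*a5 + a2*a3*a4*a5)*(a0^1 + a1^1 + a2^1 + a3^1 + a4^1 + a5^1) + (a0*a1*a2*a3*a4 + a0*a1*a2*a3*a5 + a0*a1*a2*a4*a5 + a0*a1*a3*a4*a5 + a0*a2*a3*a4*a5 + a1*a2*a3*a4*a5)*5 := by ring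
  rw [e1, e2, e3, e4, e5, p1, p2, p3, p4] at n5
  have p5 : (a0^5 + a1^5 + a2^5 + a3^5 + a4^5 + a5^5) = (-581712 - 183920*r) := by rw [n5]; linear_combination (-29888)*hr
  have x0 := hx a0 (by simp)
  have x1 := hx a1 (by simp)
  have x2 := hx a2 (by simp)
  have x3 := hx a3 (by simp)
  have x4 := hx a4 (by simp)
  have x5 := hx a5 (by simp)
  have p6 : (a0^6 + a1^6 + a2^6 + a3^6 + a4^6 + a5^6) = (9005424 + 2847664*r) := by linear_combination a0^0*x0 + a1^0*x1 + a2^0*x2 + a3^0*x3 + a4^0*x4 + a5^0*x5 - (2576+816*r)*p1 - (2620+824*r)*p2 - (800+256*r)*p3 - (110+34*r)*p4 - (12+4*r)*p5 - (-475200)*hr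
  have p7 : (a0^7 + a1^7 + a2^7 + a3^7 + a4^7 + a5^7) = (-144847008 - 45804608*r) := by linear_combination a0^1*x0 + a1^1*x1 + a2^1*x2 + a3^1*x3 + a4^1*x4 + a5^1*x5 - (1032+328*r)*p1 - (2576+816*r)*p2 - (2620+824*r)*p3 - (800+256*r)*p4 - (110+34*r)*p5 - (12+4*r)*p6 - (7624320)*hr
  have p8 : (a0^8 + a1^8 + a2^8 + a3^8 + a4^8 + a5^8) = (2366592096 + 748382592*r) := by linear_combination a0^2*x0 + a1^2*x1 + a2^2*x2 + a3^2*x3 + a4^2*x4 + a5^2*x5 - (1032+328*r)*p2 - (2576+816*r)*p3 - (2620+824*r)*p4 - (800+256*r)*p5 - (110+34*r)*p6 - (12+4*r)*p7 - (-124449600)*hr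
  have p9 : (a0^9 + a1^9 + a2^9 + a3^9 + a4^9 + a5^9) = (-38466639552 - 12164220736*r) := by linear_combination a0^3*x0 + a1^3*x1 + a2^3*x2 + a3^3*x3 + a4^3*x4 + a5^3*x5 - (1032+328*r)*p3 - (2576+816*r)*p4 - (2620+824*r)*p5 - (800+256*r)*p6 - (110+34*r)*p7 - (12+4*r)*p8 - (2022844800)*hr
  have p10 : (a0^10 + a1^10 + a2^10 + a3^10 + a4^10 + a5^10) = (622395549504 + 196818754240*r) := by linear_combination a0^4*x0 + a1^4*x1 + a2^4*x2 + a3^4*x3 + a4^4*x4 + a5^4*x5 - (1032+328*r)*p4 - (2576+816*r)*p5 - (2620+824*r)*p6 - (800+256*r)*p7 - (110+34*r)*p8 - (12+4*r)*p9 - (-32737674240)*hr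
  exact ⟨p1, p2, p3, p4, p5, p6, p7, p8, p9, p10⟩

lemma gp_eval {R : Type*} [CommRing R] (r x : R) : (gp r).eval x = x^6 + (12+4*r) * x^5 + (110+34*r) * x^4 + (800+256*r) * x^3 + (2620+824*r) * x^2 + (2576+816*r) * x + (1032+328*r) := by
  simp [gp]

lemma gp_root {R : Type*} [CommRing R] (r : R) (a : Fin 6 → R) (h : ∏ i, (X - C (a i)) = gp r) (i : Fin 6) :
    (gp r).eval (a i) = 0 := by
  rw [← h, eval_prod]; exact Finset.prod_eq_zero (Finset.mem_univ i) (by simp)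

lemma vand_sq {R : Type*} [CommRing R] (r : R) (a : Fin 6 → R) (hr : r^2 = 10)
    (h : ∏ i, (X - C (a i)) = gp r) :
    (Matrix.vandermonde a).det ^ 2 = (8623226880000 + 2726903808000*r)^2 := by
  have hx := fun i => (gp_eval r (a i)).symm.trans (gp_root r a h i)
  obtain ⟨p1, p2, p3, p4, p5, p6, p7, p8, p9, p10⟩ := gp_psum r (a 0) (a 1) (a 2) (a 3) (a 4) (a 5) hr
    (by rw [← h]; simp [Fin.prod_univ_succ, mul_assoc]) (by
      intro x hx'
      simp only [Set.mem_insert_iff, Set.mem_singleton_iff] at hx'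
      rcases hx' with rfl | rfl | rfl | rfl | rfl | rfl <;> exact hx _)
  let φ : Z10 →+* R := Zsqrtd.lift ⟨r, by push_cast; rw [← hr]; ring⟩
  have hφ : ∀ x y, φ ⟨x, y⟩ = x + y * r := fun x y => rfl
  have key : (Matrix.vandermonde a).transpose * Matrix.vandermonde a = φ.mapMatrix HK := by
    ext i j
    rw [Matrix.mul_apply]
    simp only [Matrix.transpose_apply, Matrix.vandermonde_apply, ← pow_add, RingHom.mapMatrix_apply, Matrix.map_apply]
    rw [Fin.sum_univ_six]
    fin_cases i <;> fin_cases j <;> simp [HK, hφ, p2, p3, p4, p5, p6, p7, p8, p9, p10] <;> first | done | ring1 | linear_combination p1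
  have h2 := congrArg Matrix.det key
  rw [Matrix.det_mul, Matrix.det_transpose, ← RingHom.map_det, HK_det, map_pow, hφ] at h2
  rw [sq, h2]; push_cast; ring

open Equiv in
lemma five_aux : ∀ π : Perm (Fin 6), Perm.sign π = 1 → (Finset.univ.filter (fun i => π i = i)).card = 1 →
    ∀ i j, π i ≠ i → π j ≠ j → j ∈ [i, π i, π (π i), π (π (π i)), π (π (π (π i)))] := by
  decide +kernel

lemma exists_rho {G X ι : Type*} [Group G] [MulAction G X] (a : ι → X) (ha : Function.Injective a)
    (h : ∀ (g : G) i, ∃ j, g • a i = a j) :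
    ∃ ρ : G →* Equiv.Perm ι, ∀ g i, g • a i = a (ρ g i) := by
  choose f hf using h
  let act : MulAction G ι :=
    { smul := f
      one_smul := fun i => ha (by change a (f 1 i) = a i; rw [← hf, one_smul])
      mul_smul := fun g k i => ha (by
        change a (f (g * k) i) = a (f g (f k i))
        rw [← hf, ← hf, ← hf, mul_smul]) }
  exact ⟨MulAction.toPermHom G ι, fun g i => hf g i⟩

lemma three_aux : ∀ T : Finset (Fin 6), T.card = 3 → ∃ x y z : Fin 6,
    (Equiv.swap x y * Equiv.swap x z) ∈ alternatingGroup (Fin 6) ∧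
    T.image (Equiv.swap x y * Equiv.swap x z) ≠ T ∧ T.image (Equiv.swap x y * Equiv.swap x z) ≠ Tᶜ := by
  simp only [Equiv.Perm.mem_alternatingGroup]
  decide +kernel

lemma alt_of {K : Subgroup (Equiv.Perm (Fin 6))} (hA : K ≤ alternatingGroup (Fin 6))
    (htr : ∀ i j, ∃ g ∈ K, g i = j)
    (h5 : ∃ g ∈ K, (Finset.univ.filter (fun i => g i = i)).card = 1)
    (h3 : ∃ g ∈ K, (Finset.univ.filter (fun i => g i = i)).card = 3) :
    K = alternatingGroup (Fin 6) := by
  apply le_antisymm hA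
  obtain ⟨t, ht, ht3⟩ := h3
  obtain ⟨p, hp, hp5⟩ := h5
  have h3c : t.IsThreeCycle := by
    rw [← card_support_eq_three_iff]
    have h := Finset.card_filter_add_card_filter_not (s := (Finset.univ : Finset (Fin 6))) (fun i => t i = i)
    rw [ht3] at h
    simp at h
    have e : t.support = Finset.univ.filter (fun i => ¬ t i = i) := by ext; simp
    rw [e]; omega
  refine Equiv.Perm.alternatingGroup_le_of_isPreprimitive_of_isThreeCycle_mem ?_ h3c ht
  apply MulAction.isPreprimitive_of_is_two_pretransitive
  obtain ⟨x, hx⟩ := Finset.card_eq_one.mp hp5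
  have hfix : ∀ i, p i = i ↔ i = x := fun i => by
    have := Finset.ext_iff.mp hx i
    simpa using this
  have h5' := five_aux p (Equiv.Perm.mem_alternatingGroup.mp (hA hp)) hp5
  have st : ∀ i j, i ≠ x → j ≠ x → ∃ g ∈ K, g x = x ∧ g i = j := by
    intro i j hi hj
    have hm := h5' i j (fun h => hi ((hfix i).mp h)) (fun h => hj ((hfix j).mp h))
    have hpx : p x = x := (hfix x).mpr rfl
    simp only [List.mem_cons, List.not_mem_nil, or_false] at hm
    rcases hm with h | h | h | h | h
    · exact ⟨1, K.one_mem, rfl, h.symm⟩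
    · exact ⟨p, hp, hpx, h.symm⟩
    · exact ⟨p * p, K.mul_mem hp hp, by simp [hpx], h.symm⟩
    · exact ⟨p * (p * p), K.mul_mem hp (K.mul_mem hp hp), by simp [hpx], h.symm⟩
    · exact ⟨p * (p * (p * p)), K.mul_mem hp (K.mul_mem hp (K.mul_mem hp hp)), by simp [hpx], h.symm⟩
  rw [MulAction.is_two_pretransitive_iff]
  intro a b c d hab hcd
  obtain ⟨g, hg, hga⟩ := htr a x
  obtain ⟨k, hk, hkc⟩ := htr c x
  obtain ⟨l, hl, hlx, hlb⟩ := st (g b) (k d) (fun h => hab (g.injective (hga.trans h.symm)))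
    (fun h => hcd (k.injective (hkc.trans h.symm)))
  refine ⟨⟨k⁻¹ * l * g, K.mul_mem (K.mul_mem (K.inv_mem hk) hl) hg⟩, ?_, ?_⟩
  · change k⁻¹ (l (g a)) = c
    rw [hga, hlx, ← hkc]; simp
  · change k⁻¹ (l (g b)) = d
    rw [hlb]; simp

lemma ker_le {H : Type*} [Group H] (ρ : H →* Equiv.Perm (Fin 6)) (hρ : ρ.range = alternatingGroup (Fin 6))
    (N : Subgroup H) [hN : N.Normal] (T : Finset (Fin 6)) (hT : T.card = 3)
    (h : ∀ n ∈ N, T.image (ρ n) = T ∨ T.image (ρ n) = Tᶜ) : N ≤ ρ.ker := by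
  let ρ' : H →* alternatingGroup (Fin 6) := ρ.codRestrict _ (fun x => hρ ▸ ⟨x, rfl⟩)
  have hs : Function.Surjective ρ' := by
    rintro ⟨y, hy⟩
    rw [← hρ] at hy
    obtain ⟨x, hx⟩ := hy
    exact ⟨x, Subtype.ext hx⟩
  have hn : (N.map ρ').Normal := hN.map ρ' hs
  rcases alternatingGroup.normal_subgroup_eq_bot_or_eq_top (N := N.map ρ') (by simp) with h0 | h0
  · intro n hn
    have : ρ' n ∈ N.map ρ' := ⟨n, hn, rfl⟩
    rw [h0, Subgroup.mem_bot] at this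
    exact congrArg Subtype.val this
  · exfalso
    obtain ⟨x, y, z, hxyz, h1, h2⟩ := three_aux T hT
    have : (⟨_, hxyz⟩ : alternatingGroup (Fin 6)) ∈ N.map ρ' := by rw [h0]; trivial
    obtain ⟨n, hn, hn'⟩ := this
    have e : ρ n = Equiv.swap x y * Equiv.swap x z := congrArg Subtype.val hn'
    rcases h n hn with h | h
    · rw [e] at h; exact h1 h
    · rw [e] at h; exact h2 h

def gv {R : Type*} [CommRing R] (r x : R) : R := x^6 + (12+4*r) * x^5 + (110+34*r) * x^4 + (800+256*r) * x^3 + (2620+824*r) * x^2 + (2576+816*r) * x + (1032+328*r)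

lemma gv_map {R S : Type*} [CommRing R] [CommRing S] (φ : R →+* S) (r x : R) : φ (gv r x) = gv (φ r) (φ x) := by
  simp [gv, map_ofNat]

lemma gv_eq {R : Type*} [CommRing R] (r x : R) (a : Fin 6 → R) (h : ∏ i, (X - C (a i)) = gp r) :
    gv r x = ∏ i, (x - a i) := by
  rw [gv, ← gp_eval, ← h, eval_prod]; simp

lemma gv_zero_iff {R : Type*} [CommRing R] [IsDomain R] (r x : R) (a : Fin 6 → R) (h : ∏ i, (X - C (a i)) = gp r) :
    gv r x = 0 ↔ ∃ i, x = a i := by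
  rw [gv_eq r x a h, Finset.prod_eq_zero_iff]; simp [sub_eq_zero]

lemma a_inj {R : Type*} [CommRing R] [IsDomain R] (r : R) (a : Fin 6 → R) (hr : r^2 = 10)
    (h : ∏ i, (X - C (a i)) = gp r) (hE : (8623226880000 + 2726903808000 * r : R) ≠ 0) : Function.Injective a := by
  rw [← Matrix.det_vandermonde_ne_zero_iff]
  intro h0
  have := vand_sq r a hr h
  rw [h0] at this
  exact hE (pow_eq_zero_iff (two_ne_zero) |>.mp (by rw [← this]; simp))

lemma fix_card {κ : Type*} [Field κ] (p : ℕ) [Fact p.Prime] [CharP κ p] (t : ZMod p) (a : Fin 6 → κ)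
    (h : ∏ i, (X - C (a i)) = gp (ZMod.castHom (dvd_refl p) κ t)) (ht : t^2 = 10)
    (hE : (8623226880000 + 2726903808000 * t : ZMod p) ≠ 0) (π : Equiv.Perm (Fin 6))
    (hπ : ∀ i, a i ^ p = a (π i)) :
    (Finset.univ.filter (fun i => π i = i)).card = (Finset.univ.filter (fun n : ZMod p => gv t n = 0)).card := by
  classical
  set φ := ZMod.castHom (dvd_refl p) κ with hφ
  have hφi : Function.Injective φ := φ.injective
  have hr : (φ t)^2 = 10 := by rw [← map_pow, ht, map_ofNat]
  have hai : Function.Injective a := a_inj (φ t) a hr h (by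
    intro h0; apply hE; apply hφi; rw [map_zero, ← h0]; simp [map_ofNat])
  rw [← Finset.card_image_of_injective _ hai, ← Finset.card_image_of_injective (Finset.univ.filter (fun n : ZMod p => gv t n = 0)) hφi]
  congr 1
  ext x
  simp only [Finset.mem_image, Finset.mem_filter, Finset.mem_univ, true_and]
  constructor
  · rintro ⟨i, hi, rfl⟩
    have h1 : a i ∈ (⊥ : Subfield κ) := by
      rw [Subfield.mem_bot_iff_pow_eq_self κ p, hπ, hi]
    rw [← ZMod.fieldRange_castHom_eq_bot p] at h1
    obtain ⟨n, hn⟩ := h1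
    refine ⟨n, ?_, hn⟩
    apply hφi
    rw [gv_map, map_zero, gv_zero_iff _ _ a h]
    exact ⟨i, hn⟩
  · rintro ⟨n, hn, rfl⟩
    have h1 : gv (φ t) (φ n) = 0 := by rw [← gv_map, hn, map_zero]
    rw [gv_zero_iff _ _ a h] at h1
    obtain ⟨i, hi⟩ := h1
    refine ⟨i, ?_, hi.symm⟩
    apply hai
    rw [← hπ, ← hi, ← map_pow, ZMod.pow_card]

open NumberField in
lemma frob {L : Type*} [Field L] [NumberField L] [IsGalois ℚ L] (r : 𝓞 L) (hr : r^2 = 10)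
    (hτ : ∃ τ : L ≃ₐ[ℚ] L, τ • r = -r) (p : ℕ) (hp : p.Prime) (t : ℤ) (ht : (p:ℤ) ∣ t^2 - 10)
    (ht2 : ¬ (p:ℤ) ∣ 2 * t) :
    ∃ (Q : Ideal (𝓞 L)) (σ : L ≃ₐ[ℚ] L), Q.IsMaximal ∧ σ • r = r ∧ (p : 𝓞 L) ∈ Q ∧ r - t ∈ Q ∧
      ∀ x : 𝓞 L, σ • x - x^p ∈ Q := by
  have hpu : ¬ IsUnit (p : 𝓞 L) := by
    intro h
    have := (Int.isUnit_iff.mp (isUnit_iff_exists_inv.mpr (by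
      obtain ⟨y, hy⟩ := h.exists_right_inv
      have h1 : IsIntegral ℤ ((p : ℚ)⁻¹) := by
        have h2 : IsIntegral ℤ (y : L) := y.2
        have h3 : (y : L) = algebraMap ℚ L ((p:ℚ)⁻¹) := by
          have h4 : (p : L) * (y : L) = 1 := by exact_mod_cast congrArg (algebraMap (𝓞 L) L) hy
          rw [map_inv₀, map_natCast]
          exact eq_inv_of_mul_eq_one_right h4
        rw [h3] at h2
        exact (isIntegral_algebraMap_iff (algebraMap ℚ L).injective).mp h2
      obtain ⟨z, hz⟩ := IsIntegrallyClosed.isIntegral_iff.mp h1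
      refine ⟨z, ?_⟩
      have hp0 : (p : ℚ) ≠ 0 := by exact_mod_cast hp.ne_zero
      have : (p : ℚ) * z = 1 := by rw [show (z : ℚ) = (p:ℚ)⁻¹ from hz]; field_simp
      exact_mod_cast this) : IsUnit (p : ℤ)))
    have h2 := hp.two_le
    omega
  obtain ⟨Q0, hQ0, hQp⟩ := exists_max_ideal_of_mem_nonunits hpu
  have hQ : ∃ Q : Ideal (𝓞 L), Q.IsMaximal ∧ (p : 𝓞 L) ∈ Q ∧ r - t ∈ Q := by
    obtain ⟨c, hc⟩ := ht
    have h1 : (r - t) * (r + t) ∈ Q0 := by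
      have : (r - t) * (r + t) = -(c : 𝓞 L) * (p : 𝓞 L) := by
        have : ((t^2 - 10 : ℤ) : 𝓞 L) = ((p * c : ℤ) : 𝓞 L) := by rw [hc]
        push_cast at this
        linear_combination hr - this
      rw [this]; exact Q0.mul_mem_left _ hQp
    rcases hQ0.isPrime.mem_or_mem h1 with h2 | h2
    · exact ⟨Q0, hQ0, hQp, h2⟩
    · obtain ⟨τ, hτ⟩ := hτ
      let f := MulSemiringAction.toRingEquiv (L ≃ₐ[ℚ] L) (𝓞 L) τ
      refine ⟨Q0.comap f, Ideal.comap_isMaximal_of_equiv f, ?_, ?_⟩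
      · rw [Ideal.mem_comap, map_natCast]; exact hQp
      · rw [Ideal.mem_comap, map_sub, map_intCast, show f r = -r from hτ]
        rw [show -r - (t : 𝓞 L) = -(r + t) by ring]
        exact Q0.neg_mem h2
  obtain ⟨Q, hQm, hQp, hQr⟩ := hQ
  have hQ0 : Q ≠ ⊥ := by
    rintro rfl
    rw [Ideal.mem_bot] at hQp
    exact hp.ne_zero (by exact_mod_cast hQp)
  have : Finite (𝓞 L ⧸ Q) := Ideal.finiteQuotientOfFreeOfNeBot Q hQ0
  have := hQm.isPrime
  obtain ⟨σ, hσ⟩ := IsArithFrobAt.exists_of_isInvariant ℤ (L ≃ₐ[ℚ] L) Q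
  have hu : Q.under ℤ = Ideal.span {(p : ℤ)} := by
    have hle : Ideal.span {(p : ℤ)} ≤ Q.under ℤ := by
      rw [Ideal.span_singleton_le_iff_mem, Ideal.mem_comap]; simpa using hQp
    have hmax : (Ideal.span {(p : ℤ)}).IsMaximal :=
      PrincipalIdealRing.isMaximal_of_irreducible (Nat.prime_iff_prime_int.mp hp).irreducible
    exact (hmax.eq_of_le (Ideal.IsPrime.ne_top inferInstance) hle).symm
  have hfr : ∀ x : 𝓞 L, σ • x - x^p ∈ Q := by
    intro x
    have := hσ x
    rw [hu, Int.card_ideal_quot] at this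
    exact this
  refine ⟨Q, σ, hQm, ?_, hQp, hQr, hfr⟩
  have h1 : σ • r = r ∨ σ • r = -r := by
    apply sq_eq_sq_iff_eq_or_eq_neg.mp
    rw [← smul_pow', hr]
    exact map_ofNat (MulSemiringAction.toRingHom (L ≃ₐ[ℚ] L) (𝓞 L) σ) 10
  refine h1.resolve_right ?_
  intro h2
  have h3 := hfr r
  rw [h2] at h3
  have hint : ∀ n : ℤ, (n : 𝓞 L) ∈ Q → (p : ℤ) ∣ n := by
    intro n hn
    have : n ∈ Q.under ℤ := by rw [Ideal.mem_comap]; simpa using hn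
    rwa [hu, Ideal.mem_span_singleton] at this
  apply ht2
  have h4 : (p : ℤ) ∣ t^p - t := by
    have := Fact.mk hp
    rw [← ZMod.intCast_zmod_eq_zero_iff_dvd]
    push_cast; rw [ZMod.pow_card, sub_self]
  have h5 : (p : ℤ) ∣ t + t^p := by
    apply hint
    push_cast
    have h6 : r^p - (t:𝓞 L)^p ∈ Q := Ideal.mem_of_dvd _ (sub_dvd_pow_sub_pow r (t : 𝓞 L) p) hQr
    have : (t : 𝓞 L) + (t:𝓞 L)^p = -((-r - r^p) + (r - t) + (r^p - (t:𝓞 L)^p)) := by ring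
    rw [this]
    exact Q.neg_mem (Q.add_mem (Q.add_mem h3 hQr) h6)
  have := dvd_sub h5 h4
  rwa [show t + t^p - (t^p - t) = 2 * t by ring] at this

lemma gp_map {R S : Type*} [CommRing R] [CommRing S] (φ : R →+* S) (r : R) : (gp r).map φ = gp (φ r) := by
  simp [gp, map_ofNat]

lemma E_ne {L : Type*} [Field L] [CharZero L] (r : L) (hr : r^2 = 10) :
    (8623226880000 + 2726903808000 * r : L) ≠ 0 := by
  intro h
  have : ((8623226880000^2 - 10 * 2726903808000^2 : ℚ) : L) = 0 := by
    push_cast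
    linear_combination (8623226880000 - 2726903808000 * r) * h + 2726903808000^2 * hr
  rw [Rat.cast_eq_zero] at this
  norm_num at this

section
set_option linter.unusedSectionVars false
variable {L : Type*} [Field L] [NumberField L] [IsGalois ℚ L]

lemma f2_eq (r x : L) (hr : r^2 = 10) : aeval x f2 = gv r x * gv (-r) x := by
  rw [aeval_f2, gv, gv]
  linear_combination (328+816*x+824*x^2+256*x^3+34*x^4+4*x^5)^2 * hr

lemma sep (r x : L) (hr : r^2 = 10) (h1 : gv r x = 0) (h2 : gv (-r) x = 0) : False := by
  have hx : aeval x f2 = 0 := by rw [f2_eq r x hr, h1, zero_mul]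
  have hm := f2_minpoly x hx
  let q : ℚ[X] := X^6 + C 12 * X^5 + C 110 * X^4 + C 800 * X^3 + C 2620 * X^2 + C 2576 * X + C 1032
  have hq : q.natDegree = 6 := by simp only [q]; compute_degree!
  have hq0 : q ≠ 0 := by rintro h; rw [h] at hq; simp at hq
  have hqx : aeval x q = 0 := by
    simp only [q, map_add, map_mul, map_pow, aeval_X, map_ofNat]
    rw [gv] at h1 h2
    linear_combination (h1 + h2) / 2
  have := natDegree_le_of_dvd (minpoly.dvd ℚ x hqx) hq0
  rw [hm, f2_deg, hq] at this
  omega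

lemma sig_r (r : L) (hr : r^2 = 10) (σ : L ≃ₐ[ℚ] L) : σ r = r ∨ σ r = -r := by
  apply sq_eq_sq_iff_eq_or_eq_neg.mp
  rw [← map_pow, hr, map_ofNat]

lemma sig_gv (r x : L) (σ : L ≃ₐ[ℚ] L) (h : gv r x = 0) : gv (σ r) (σ x) = 0 := by
  have := gv_map (σ : L →+* L) r x
  rw [h, map_zero] at this
  exact this.symm

lemma same (r x y : L) (hr : r^2 = 10) (σ : L ≃ₐ[ℚ] L) (hx : gv r x = 0) (hy : gv r y = 0)
    (h : σ x = y) : σ r = r := by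
  refine (sig_r r hr σ).resolve_right fun h1 => ?_
  have := sig_gv r x σ hx
  rw [h, h1] at this
  exact sep r y hr hy this

lemma diff (r x y : L) (hr : r^2 = 10) (σ : L ≃ₐ[ℚ] L) (hx : gv r x = 0) (hy : gv (-r) y = 0)
    (h : σ x = y) : σ r = -r := by
  refine (sig_r r hr σ).resolve_left fun h1 => ?_
  have := sig_gv r x σ hx
  rw [h, h1] at this
  exact sep r y hr this hy

lemma trans_f2 (x y : L) (hx : aeval x f2 = 0) (hy : aeval y f2 = 0) : ∃ σ : L ≃ₐ[ℚ] L, σ x = y := by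
  apply isConjRoot_iff_exists_algEquiv.mp
  rw [isConjRoot_def, f2_minpoly x hx, f2_minpoly y hy]

open NumberField in
lemma blk_frob (r : L) (a : Fin 6 → L) (hr : r^2 = 10) (h : ∏ i, (X - C (a i)) = gp r)
    (hτ : ∃ τ : L ≃ₐ[ℚ] L, τ r = -r) (H : Subgroup (L ≃ₐ[ℚ] L)) (hH : ∀ σ, σ ∈ H ↔ σ r = r)
    (ρ : H →* Equiv.Perm (Fin 6)) (hρ : ∀ (σ : H) i, (σ : L ≃ₐ[ℚ] L) (a i) = a (ρ σ i))
    (p : ℕ) (hp : p.Prime) (t : ℤ) (ht : (p:ℤ) ∣ t^2 - 10)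
    (ht2 : ¬ (p:ℤ) ∣ 2 * t) (hE : (8623226880000 + 2726903808000 * t : ZMod p) ≠ 0) :
    ∃ σ, (Finset.univ.filter (fun i => ρ σ i = i)).card =
      (Set.ncard {n : ZMod p | gv (t : ZMod p) n = 0}) := by
  have := Fact.mk hp
  have hri : IsIntegral ℤ r := ⟨X^2 - C 10, by monicity!, by simp [hr]⟩
  have hai : ∀ i, IsIntegral ℤ (a i) := fun i => by
    have h1 : aeval (a i) f2 = 0 := by
      rw [f2_eq r (a i) hr, (gv_zero_iff r (a i) a h).mpr ⟨i, rfl⟩, zero_mul]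
    refine ⟨fZ, fZ_monic, ?_⟩
    rw [← fZ_map, aeval_def, eval₂_map] at h1
    rw [← h1]; congr 1; exact Subsingleton.elim _ _
  let rI : 𝓞 L := ⟨r, hri⟩
  let aI : Fin 6 → 𝓞 L := fun i => ⟨a i, hai i⟩
  have hrI : rI^2 = 10 := by
    apply RingOfIntegers.coe_injective
    change algebraMap (𝓞 L) L (rI^2) = algebraMap (𝓞 L) L 10
    rw [map_pow, map_ofNat]; exact hr
  have hI : ∏ i, (X - C (aI i)) = gp rI := by
    apply Polynomial.map_injective (algebraMap (𝓞 L) L) RingOfIntegers.coe_injective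
    rw [gp_map, Polynomial.map_prod]
    simp only [Polynomial.map_sub, map_X, map_C]
    exact h
  obtain ⟨Q, σ, hQ, hσr, hQp, hQr, hfr⟩ := frob rI hrI (by
    obtain ⟨τ, hτ⟩ := hτ
    exact ⟨τ, RingOfIntegers.ext hτ⟩) p hp t ht ht2
  have hσ : σ ∈ H := (hH σ).mpr (congrArg (algebraMap (𝓞 L) L) hσr)
  refine ⟨⟨σ, hσ⟩, ?_⟩
  let _ : Field (𝓞 L ⧸ Q) := Ideal.Quotient.field Q
  have hch : CharP (𝓞 L ⧸ Q) p := by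
    apply (CharP.charP_iff_prime_eq_zero hp).mpr
    rw [← map_natCast (Ideal.Quotient.mk Q), Ideal.Quotient.eq_zero_iff_mem]; exact hQp
  have hφr : Ideal.Quotient.mk Q rI = ZMod.castHom (dvd_refl p) (𝓞 L ⧸ Q) (t : ZMod p) := by
    rw [map_intCast, ← map_intCast (Ideal.Quotient.mk Q), Ideal.Quotient.eq]; exact hQr
  have key := fix_card p (t : ZMod p) (fun i => Ideal.Quotient.mk Q (aI i)) (by
      rw [← hφr, ← gp_map, ← hI, Polynomial.map_prod]
      simp only [Polynomial.map_sub, map_X, map_C])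
    (by
      rw [← sub_eq_zero]
      have := (ZMod.intCast_zmod_eq_zero_iff_dvd _ p).mpr ht
      push_cast at this; exact this) hE (ρ ⟨σ, hσ⟩) (by
      intro i
      rw [← map_pow]
      have e : aI (ρ ⟨σ, hσ⟩ i) = σ • aI i := RingOfIntegers.ext (hρ ⟨σ, hσ⟩ i).symm
      rw [e]
      exact ((Ideal.Quotient.eq).mpr (hfr (aI i))).symm)
  rw [key, ← Set.ncard_coe_finset]
  congr 1
  ext; simp

lemma blk_sign (r : L) (a : Fin 6 → L) (hr : r^2 = 10) (h : ∏ i, (X - C (a i)) = gp r)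
    (σ : L ≃ₐ[ℚ] L) (hσ : σ r = r) (π : Equiv.Perm (Fin 6)) (hπ : ∀ i, σ (a i) = a (π i)) :
    Equiv.Perm.sign π = 1 := by
  have hV := vand_sq r a hr h
  have hV0 : (Matrix.vandermonde a).det ≠ 0 :=
    Matrix.det_vandermonde_ne_zero_iff.mpr (a_inj r a hr h (E_ne r hr))
  have h1 : σ (Matrix.vandermonde a).det = (Matrix.vandermonde a).det := by
    rcases sq_eq_sq_iff_eq_or_eq_neg.mp hV with h | h <;> rw [h] <;> simp [hσ, map_ofNat]
  have h2 : σ (Matrix.vandermonde a).det = ((Matrix.vandermonde a).submatrix π id).det := by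
    have e := RingHom.map_det (σ : L →+* L) (Matrix.vandermonde a)
    refine e.trans ?_
    congr 1
    ext i j
    simp [Matrix.vandermonde_apply, hπ]
  rw [h1, Matrix.det_permute] at h2
  rcases Int.units_eq_one_or (Equiv.Perm.sign π) with h3 | h3
  · exact h3
  · rw [h3] at h2
    simp at h2
    exact absurd (self_eq_neg.mp h2) hV0

lemma blk (r : L) (a : Fin 6 → L) (hr : r^2 = 10) (h : ∏ i, (X - C (a i)) = gp r)
    (hτ : ∃ τ : L ≃ₐ[ℚ] L, τ r = -r) (H : Subgroup (L ≃ₐ[ℚ] L)) (hH : ∀ σ, σ ∈ H ↔ σ r = r) :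
    ∃ ρ : H →* Equiv.Perm (Fin 6), (∀ (σ : H) i, (σ : L ≃ₐ[ℚ] L) (a i) = a (ρ σ i)) ∧
      ρ.range = alternatingGroup (Fin 6) := by
  have hz : ∀ i, gv r (a i) = 0 := fun i => (gv_zero_iff r (a i) a h).mpr ⟨i, rfl⟩
  have hf : ∀ i, aeval (a i) f2 = 0 := fun i => by rw [f2_eq r _ hr, hz, zero_mul]
  obtain ⟨ρ, hρ⟩ := exists_rho (G := H) a (a_inj r a hr h (E_ne r hr)) (by
    intro σ i
    have := sig_gv r (a i) σ (hz i)
    rw [(hH σ).mp σ.2, gv_zero_iff _ _ a h] at this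
    exact this)
  have hρ' : ∀ (σ : H) i, (σ : L ≃ₐ[ℚ] L) (a i) = a (ρ σ i) := hρ
  refine ⟨ρ, hρ', alt_of ?_ ?_ ?_ ?_⟩
  · rintro _ ⟨σ, rfl⟩
    exact Equiv.Perm.mem_alternatingGroup.mpr
      (blk_sign r a hr h σ ((hH σ).mp σ.2) _ (hρ' σ))
  · intro i j
    obtain ⟨σ, hσ⟩ := trans_f2 (a i) (a j) (hf i) (hf j)
    have hσH := (hH σ).mpr (same r _ _ hr σ (hz i) (hz j) hσ)
    refine ⟨_, ⟨⟨σ, hσH⟩, rfl⟩, ?_⟩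
    apply a_inj r a hr h (E_ne r hr)
    rw [← hρ', ← hσ]
  · obtain ⟨σ, hσ⟩ := blk_frob r a hr h hτ H hH ρ hρ' 13 (by norm_num) 6 (by norm_num) (by norm_num)
      (by decide)
    refine ⟨_, ⟨σ, rfl⟩, hσ.trans ?_⟩
    rw [show {n : ZMod 13 | gv ((6 : ℤ) : ZMod 13) n = 0} =
      ((Finset.univ.filter (fun n : ZMod 13 => gv ((6 : ℤ) : ZMod 13) n = 0) : Finset _) : Set _) by ext; simp,
      Set.ncard_coe_finset]
    decide +kernel
  · obtain ⟨σ, hσ⟩ := blk_frob r a hr h hτ H hH ρ hρ' 37 (by norm_num) 11 (by norm_num) (by norm_num)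
      (by decide)
    refine ⟨_, ⟨σ, rfl⟩, hσ.trans ?_⟩
    rw [show {n : ZMod 37 | gv ((11 : ℤ) : ZMod 37) n = 0} =
      ((Finset.univ.filter (fun n : ZMod 37 => gv ((11 : ℤ) : ZMod 37) n = 0) : Finset _) : Set _) by ext; simp,
      Set.ncard_coe_finset]
    decide +kernel
end

noncomputable def cp {F : Type*} [Field F] (u r s : F) : F[X] :=
  X^3 + C (6 + 2*r + s/2) * X^2 + C (Cub.m1 u r + s * Cub.n1 u r / 2) * X + C (Cub.m0 u r + s * Cub.n0 u r / 2)

lemma cp_monic {F : Type*} [Field F] (u r s : F) : (cp u r s).Monic := by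
  rw [cp]; monicity!

lemma cp_deg {F : Type*} [Field F] (u r s : F) : (cp u r s).natDegree = 3 := by
  rw [cp]; compute_degree!

lemma cp_mul {F : Type*} [Field F] [CharZero F] (u r s : F) (hr : r^2 = 10) (hu : Cub.p10 u = 0)
    (hs : s^2 = Cub.w u r) : cp u r s * cp u r (-s) = gp r := by
  have h4 := Cub.id4 u r hr hu
  have h3 := Cub.id3 u r hr hu
  have h2 := Cub.id2 u r hr hu
  have h1 := Cub.id1 u r hr hu
  have h0 := Cub.id0 u r hr hu
  have hy := Cub.idy u r hr hu
  have e : cp u r s * cp u r (-s) = X^6 + C (12 + 4*r) * X^5 +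
    C (2 * Cub.m1 u r + (6+2*r)^2 - s^2/4) * X^4 +
    C (2 * Cub.m0 u r + 2*(6+2*r) * Cub.m1 u r - s^2 * Cub.n1 u r / 2) * X^3 +
    C (Cub.m1 u r^2 + 2*(6+2*r)*Cub.m0 u r - s^2*Cub.n1 u r^2/4 - s^2 * Cub.n0 u r / 2) * X^2 +
    C (2 * Cub.m1 u r * Cub.m0 u r - s^2 * Cub.n1 u r * Cub.n0 u r / 2) * X +
    C (Cub.m0 u r^2 - s^2 * Cub.n0 u r^2 / 4) := by
    have hh : C (s/2) * 2 = C s := by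
      rw [show (2 : F[X]) = C 2 from (map_ofNat C 2).symm, ← C_mul]; congr 1; field_simp
    set n1 := Cub.n1 u r
    set n0 := Cub.n0 u r
    set m1 := Cub.m1 u r
    set m0 := Cub.m0 u r
    rw [cp, cp]
    obtain ⟨q, rfl⟩ : ∃ q, s = 2*q := ⟨s/2, by field_simp⟩
    rw [show 2*q/2 = q by field_simp, show -(2*q)/2 = -q by field_simp,
      show 2*q*n1/2 = q*n1 by field_simp, show -(2*q)*n1/2 = -(q*n1) by field_simp,
      show 2*q*n0/2 = q*n0 by field_simp, show -(2*q)*n0/2 = -(q*n0) by field_simp,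
      show (2*q)^2/4 = q^2 by ring, show (2*q)^2*n1/2 = 2*q^2*n1 by ring,
      show (2*q)^2*n1^2/4 = q^2*n1^2 by ring, show (2*q)^2*n0/2 = 2*q^2*n0 by ring,
      show (2*q)^2*n1*n0/2 = 2*q^2*n1*n0 by ring, show (2*q)^2*n0^2/4 = q^2*n0^2 by ring]
    simp only [map_add, map_sub, map_mul, map_neg, map_pow, map_ofNat]
    ring
  rw [hs] at e
  rw [e, gp]
  clear e hs
  generalize Cub.n1 u r = n1 at *
  generalize Cub.n0 u r = n0 at *
  generalize Cub.m1 u r = m1 at *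
  generalize Cub.m0 u r = m0 at *
  generalize Cub.w u r = w at *
  generalize Cub.y5 u r = y5 at *
  have c4 : 2 * m1 + (6+2*r)^2 - w/4 = 110+34*r := by linear_combination -h4
  have c3 : 2 * m0 + 2*(6+2*r) * m1 - w * n1 / 2 = 800+256*r := by linear_combination -h3
  have c2 : m1^2 + 2*(6+2*r)*m0 - w*n1^2/4 - w * n0 / 2 = 2620+824*r := by
    linear_combination -h2 - n1 / 2 * h3 - hy / 2
  have c1 : 2 * m1 * m0 - w * n1 * n0 / 2 = 2576+816*r := by linear_combination -h1 - n0 * h3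
  have c0 : m0^2 - w * n0^2 / 4 = 1032+328*r := by linear_combination -h0 - n0 / 4 * hy
  rw [c4, c3, c2, c1, c0]

lemma coef3 {F : Type*} [Field F] (a b c d e f : F)
    (h : (X^3 + C a * X^2 + C b * X + C c : F[X]) = X^3 + C d * X^2 + C e * X + C f) : a = d ∧ b = e ∧ c = f := by
  have k := fun k => congrArg (fun q => coeff q k) h
  have a2 := k 2
  have a1 := k 1
  have a0 := k 0
  simp [coeff_X, coeff_C, coeff_X_pow, coeff_C_mul] at a2 a1 a0
  exact ⟨a2, a1, a0⟩

lemma fixpoly {L : Type*} [Field L] (φ : L →+* L) (a : Fin 6 → L) (hφ : ∀ i, φ (a i) = a i) (q : L[X])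
    (hq : q.Monic) (hd : q ∣ ∏ i, (X - C (a i))) : q.map φ = q := by
  have hp0 : ∏ i, (X - C (a i)) ≠ 0 := (monic_prod_of_monic _ _ fun i _ => monic_X_sub_C _).ne_zero
  have hsp : q.Splits := Splits.of_dvd (Splits.prod fun i _ => Splits.X_sub_C _) hp0 hd
  have hroot : ∀ x ∈ q.roots, φ x = x := by
    intro x hx
    have h1 := eval_eq_zero_of_dvd_of_eval_eq_zero hd (isRoot_of_mem_roots hx)
    rw [eval_prod, Finset.prod_eq_zero_iff] at h1
    obtain ⟨i, -, hi⟩ := h1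
    simp [sub_eq_zero] at hi
    rw [hi, hφ]
  have h := hsp.eq_prod_roots_of_monic hq
  conv_lhs => rw [h]
  conv_rhs => rw [h]
  rw [Polynomial.map_multiset_prod, Multiset.map_map]
  congr 1
  apply Multiset.map_congr rfl
  intro x hx
  simp [hroot x hx]

lemma cp_map {L : Type*} [Field L] [CharZero L] (φ : L →+* L) (u r s : L) :
    (cp u r s).map φ = cp (φ u) (φ r) (φ s) := by
  simp [cp, Cub.m1, Cub.m0, Cub.n1, Cub.n0, map_ofNat]

lemma fix_u {L : Type*} [Field L] [CharZero L] (φ : L →+* L) (u r s : L) (hr : r^2 = 10) (hu : Cub.p10 u = 0)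
    (hs : s^2 = Cub.w u r) (a : Fin 6 → L) (h : ∏ i, (X - C (a i)) = gp r)
    (hφr : φ r = r) (hφ : ∀ i, φ (a i) = a i) : φ u = u := by
  have hd := cp_mul u r s hr hu hs
  have e1 := fixpoly φ a hφ (cp u r s) (cp_monic _ _ _) (by rw [h, ← hd]; exact dvd_mul_right _ _)
  have e2 := fixpoly φ a hφ (cp u r (-s)) (cp_monic _ _ _) (by rw [h, ← hd]; exact dvd_mul_left _ _)
  simp only [cp, Polynomial.map_add, Polynomial.map_mul, Polynomial.map_pow, map_X, map_C] at e1 e2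
  obtain ⟨a2, a1, a0⟩ := coef3 _ _ _ _ _ _ e1
  obtain ⟨-, b1, b0⟩ := coef3 _ _ _ _ _ _ e2
  simp only [map_add, map_mul, map_div₀, map_neg, map_ofNat, hφr] at a2 a1 a0 b1 b0
  have hss : φ s = s := by
    linear_combination 2 * a2
  rw [hss] at a1 a0 b1 b0
  have f1 : φ (Cub.m1 u r) = Cub.m1 u r := by linear_combination (a1 + b1) / 2
  have f0 : φ (Cub.m0 u r) = Cub.m0 u r := by linear_combination (a0 + b0) / 2
  have f5 : φ (Cub.y5 u r) = Cub.y5 u r := by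
    rw [← Cub.idy u r hr hu, ← hs, map_mul, map_pow, hss]
    linear_combination s * (a0 - b0)
  have hU := Cub.idu u r hr hu
  rw [← hU]
  simp only [map_add, map_sub, map_neg, map_mul, map_div₀, map_ofNat, map_one, f1, f0, f5, hφr]

lemma split3 {L : Type*} [Field L] [CharZero L] [DecidableEq L] (u r s : L) (hr : r^2 = 10) (hu : Cub.p10 u = 0)
    (hs : s^2 = Cub.w u r) (a : Fin 6 → L) (h : ∏ i, (X - C (a i)) = gp r) :
    (Finset.univ.filter fun i => (cp u r s).eval (a i) = 0).card = 3 ∧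
    (Finset.univ.filter fun i => (cp u r (-s)).eval (a i) = 0) =
      (Finset.univ.filter fun i => (cp u r s).eval (a i) = 0)ᶜ := by
  have hd := cp_mul u r s hr hu hs
  have hinj := a_inj r a hr h (E_ne r hr)
  have le3 : ∀ s : L, (Finset.univ.filter fun i => (cp u r s).eval (a i) = 0).card ≤ 3 := by
    intro s
    rw [← Finset.card_image_of_injective _ hinj, ← cp_deg u r s]
    refine le_trans (Finset.card_le_card ?_) ((Multiset.toFinset_card_le _).trans (card_roots' (cp u r s)))
    intro x hx
    simp only [Finset.mem_image, Finset.mem_filter, Finset.mem_univ, true_and] at hx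
    obtain ⟨i, hi, rfl⟩ := hx
    rw [Multiset.mem_toFinset, mem_roots (cp_monic _ _ _).ne_zero]
    exact hi
  set T := Finset.univ.filter fun i => (cp u r s).eval (a i) = 0
  set T' := Finset.univ.filter fun i => (cp u r (-s)).eval (a i) = 0
  have hun : Tᶜ ⊆ T' := by
    intro i hi
    simp only [T, T', Finset.mem_compl, Finset.mem_filter, Finset.mem_univ, true_and] at hi ⊢
    have := gp_root r a h i
    rw [← hd, eval_mul] at this
    exact (mul_eq_zero.mp this).resolve_left hi
  have h1 : T.card ≤ 3 := le3 s
  have h2 : T'.card ≤ 3 := le3 (-s)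
  have h3 := Finset.card_le_card hun
  rw [Finset.card_compl, Fintype.card_fin] at h3
  refine ⟨by omega, ?_⟩
  symm
  apply Finset.eq_of_subset_of_card_le hun
  rw [Finset.card_compl, Fintype.card_fin]
  omega

lemma ker_part {L : Type*} [Field L] [CharZero L] [DecidableEq L] (φ : L →+* L) (u r s s' : L) (hr : r^2 = 10) (hu : Cub.p10 u = 0)
    (hs : s^2 = Cub.w u r) (hs' : s'^2 = Cub.w u (-r)) (a b : Fin 6 → L) (h : ∏ i, (X - C (a i)) = gp r)
    (h' : ∏ i, (X - C (b i)) = gp (-r))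
    (hφr : φ r = r) (hφ : ∀ i, φ (a i) = a i) (π : Equiv.Perm (Fin 6)) (hπ : ∀ i, φ (b i) = b (π i)) :
    (Finset.univ.filter fun i => (cp u (-r) s').eval (b i) = 0).image π =
      (Finset.univ.filter fun i => (cp u (-r) s').eval (b i) = 0) ∨
    (Finset.univ.filter fun i => (cp u (-r) s').eval (b i) = 0).image π =
      (Finset.univ.filter fun i => (cp u (-r) s').eval (b i) = 0)ᶜ := by
  have hfu := fix_u φ u r s hr hu hs a h hφr hφ
  have hr' : (-r)^2 = 10 := by rw [neg_sq, hr]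
  obtain ⟨h3, hc⟩ := split3 u (-r) s' hr' hu hs' b h'
  have hws : φ s' = s' ∨ φ s' = -s' := by
    apply sq_eq_sq_iff_eq_or_eq_neg.mp
    rw [← map_pow, hs']
    simp [Cub.w, map_ofNat, hfu, hφr]
  have key : ∀ i, (cp u (-r) s').eval (b i) = 0 → (cp u (-r) (φ s')).eval (b (π i)) = 0 := by
    intro i hi
    have := congrArg φ hi
    rw [← eval_map_apply, cp_map, map_zero, hfu, map_neg, hφr, hπ] at this
    exact this
  rw [← hc]
  rcases hws with e | e <;> rw [e] at key
  · left
    apply Finset.eq_of_subset_of_card_le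
    · intro x hx
      simp only [Finset.mem_image, Finset.mem_filter, Finset.mem_univ, true_and] at hx ⊢
      obtain ⟨i, hi, rfl⟩ := hx
      exact key i hi
    · rw [Finset.card_image_of_injective _ π.injective]
  · right
    apply Finset.eq_of_subset_of_card_le
    · intro x hx
      simp only [Finset.mem_image, Finset.mem_filter, Finset.mem_univ, true_and] at hx ⊢
      obtain ⟨i, hi, rfl⟩ := hx
      exact key i hi
    · rw [Finset.card_image_of_injective _ π.injective, hc, Finset.card_compl, h3]; simp

section
variable {L : Type*} [Field L] [NumberField L] [IsGalois ℚ L]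

lemma f2_splits (r : L) (hr : r^2 = 10) (a b : Fin 6 → L) (h : ∏ i, (X - C (a i)) = gp r)
    (h' : ∏ i, (X - C (b i)) = gp (-r)) : (f2.map (algebraMap ℚ L)).Splits := by
  have e : f2.map (algebraMap ℚ L) = gp r * gp (-r) := by
    apply Polynomial.funext
    intro x
    rw [eval_map_algebraMap, f2_eq r x hr, eval_mul, gv_eq r x a h, gv_eq (-r) x b h', ← h, ← h', eval_prod, eval_prod]
    simp only [eval_sub, eval_X, eval_C]
  rw [e, ← h, ← h']
  exact (Splits.prod fun i _ => Splits.X_sub_C _).mul (Splits.prod fun i _ => Splits.X_sub_C _)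

lemma gal_card (u r s s' : L) (hr : r^2 = 10) (hu : Cub.p10 u = 0)
    (hs : s^2 = Cub.w u r) (hs' : s'^2 = Cub.w u (-r)) (a b : Fin 6 → L)
    (h : ∏ i, (X - C (a i)) = gp r) (h' : ∏ i, (X - C (b i)) = gp (-r)) :
    Nat.card f2.Gal = 720 := by
  classical
  have hr' : (-r)^2 = 10 := by rw [neg_sq, hr]
  have ga : ∀ i, gv r (a i) = 0 := fun i => (gv_zero_iff r _ a h).mpr ⟨i, rfl⟩
  have gb : ∀ i, gv (-r) (b i) = 0 := fun i => (gv_zero_iff (-r) _ b h').mpr ⟨i, rfl⟩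
  have fa : ∀ i, aeval (a i) f2 = 0 := fun i => by rw [f2_eq r _ hr, ga, zero_mul]
  have fb : ∀ i, aeval (b i) f2 = 0 := fun i => by rw [f2_eq r _ hr, gb, mul_zero]
  have hτ : ∃ τ : L ≃ₐ[ℚ] L, τ r = -r := by
    obtain ⟨τ, hτ⟩ := trans_f2 (a 0) (b 0) (fa 0) (fb 0)
    exact ⟨τ, diff r _ _ hr τ (ga 0) (gb 0) hτ⟩
  have hτ' : ∃ τ : L ≃ₐ[ℚ] L, τ (-r) = - -r := by
    obtain ⟨τ, e⟩ := hτ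
    exact ⟨τ, by rw [map_neg, e]⟩
  set H : Subgroup (L ≃ₐ[ℚ] L) := MulAction.stabilizer (L ≃ₐ[ℚ] L) r with hHdef
  have hH : ∀ σ, σ ∈ H ↔ σ r = r := fun σ => MulAction.mem_stabilizer_iff
  have hH' : ∀ σ, σ ∈ H ↔ σ (-r) = -r := fun σ => by rw [hH, map_neg, neg_inj]
  have hr0 : r ≠ 0 := by
    rintro rfl
    norm_num at hr
  have hrn : r ≠ -r := by
    intro e
    exact hr0 (self_eq_neg.mp e)
  have hidx : H.index = 2 := by
    rw [hHdef, MulAction.index_stabilizer]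
    have : MulAction.orbit (L ≃ₐ[ℚ] L) r = {r, -r} := by
      ext x
      simp only [MulAction.mem_orbit_iff, Set.mem_insert_iff, Set.mem_singleton_iff]
      constructor
      · rintro ⟨σ, rfl⟩
        apply sq_eq_sq_iff_eq_or_eq_neg.mp
        rw [AlgEquiv.smul_def, ← map_pow, hr, map_ofNat]
      · rintro (rfl | rfl)
        · exact ⟨1, rfl⟩
        · obtain ⟨τ, e⟩ := hτ
          exact ⟨τ, e⟩
    rw [this, Set.ncard_pair hrn]
  obtain ⟨ρ, hρ, hρr⟩ := blk r a hr h hτ H hH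
  obtain ⟨ρ', hρ', hρr'⟩ := blk (-r) b hr' h' hτ' H hH'
  have ha := a_inj r a hr h (E_ne r hr)
  have hb := a_inj (-r) b hr' h' (E_ne (-r) hr')
  have kera : ∀ σ : H, σ ∈ ρ.ker → ∀ i, (σ : L ≃ₐ[ℚ] L) (a i) = a i := by
    intro σ hσ i
    rw [hρ, MonoidHom.mem_ker.mp hσ]; rfl
  have kle : ρ.ker ≤ ρ'.ker := by
    obtain ⟨h3, hc⟩ := split3 u (-r) s' hr' hu hs' b h'
    refine ker_le ρ' hρr' ρ.ker _ h3 ?_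
    intro σ hσ
    refine ker_part ((σ : L ≃ₐ[ℚ] L) : L →+* L) u r s s' hr hu hs hs' a b h h' ?_ ?_ (ρ' σ) ?_
    · exact (hH σ).mp σ.2
    · exact kera σ hσ
    · exact hρ' σ
  have : Fact ((f2.map (algebraMap ℚ L)).Splits) := ⟨f2_splits r hr a b h h'⟩
  set N := (Polynomial.Gal.restrict f2 L).ker with hN
  have memN : ∀ σ, σ ∈ N ↔ ∀ x : L, aeval x f2 = 0 → σ x = x := by
    intro σ
    have hinj := Polynomial.Gal.galActionHom_injective f2 L
    rw [hN, MonoidHom.mem_ker, ← map_eq_one_iff _ hinj]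
    constructor
    · intro e x hx
      have hx' : x ∈ f2.rootSet L := by
        rw [mem_rootSet]; exact ⟨f2_irr.ne_zero, hx⟩
      have := Polynomial.Gal.restrict_smul (p := f2) σ ⟨x, hx'⟩
      rw [← this]
      have e2 := congrArg (fun q => q ⟨x, hx'⟩) e
      exact congrArg Subtype.val e2
    · intro e
      ext ⟨x, hx'⟩
      have := Polynomial.Gal.restrict_smul (p := f2) σ ⟨x, hx'⟩
      refine this.trans ?_
      exact e x (mem_rootSet.mp hx').2
  have hNH : N ≤ H := by
    intro σ hσ
    rw [hH]
    exact same r (a 0) (a 0) hr σ (ga 0) (ga 0) ((memN σ).mp hσ _ (fa 0))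
  have hsub : N.subgroupOf H = ρ.ker := by
    ext σ
    rw [Subgroup.mem_subgroupOf, memN]
    constructor
    · intro e
      rw [MonoidHom.mem_ker]
      ext i : 1
      apply ha
      rw [← hρ, e _ (fa i)]; rfl
    · intro e x hx
      rw [f2_eq r x hr, mul_eq_zero] at hx
      rcases hx with hx | hx
      · obtain ⟨i, rfl⟩ := (gv_zero_iff r _ a h).mp hx
        exact kera σ e i
      · obtain ⟨i, rfl⟩ := (gv_zero_iff (-r) _ b h').mp hx
        rw [hρ', MonoidHom.mem_ker.mp (kle e)]; rfl
  have c1 : N.index = Nat.card f2.Gal := by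
    rw [hN, Subgroup.index_ker, MonoidHom.range_eq_top.mpr (Polynomial.Gal.restrict_surjective f2 L)]
    exact Nat.card_congr Subgroup.topEquiv.toEquiv
  have c2 : N.relIndex H = 360 := by
    rw [Subgroup.relIndex, hsub, Subgroup.index_ker, hρr]
    have := two_mul_nat_card_alternatingGroup (α := Fin 6)
    rw [Nat.card_perm, Nat.card_fin] at this
    have h6 : Nat.factorial 6 = 720 := rfl
    rw [h6] at this
    exact Nat.eq_of_mul_eq_mul_left two_pos this
  rw [← c1, ← Subgroup.relIndex_mul_index hNH, c2, hidx]
end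

lemma roots6 {F : Type*} [Field F] [IsAlgClosed F] (r : F) : ∃ a : Fin 6 → F, ∏ i, (X - C (a i)) = gp r := by
  have hm : (gp r).Monic := by rw [gp]; monicity!
  have hd : (gp r).natDegree = 6 := by rw [gp]; compute_degree!
  have hs := IsAlgClosed.splits (gp r)
  have e := hs.eq_prod_roots_of_monic hm
  have hc : (gp r).roots.card = 6 := by rw [← hs.natDegree_eq_card_roots, hd]
  obtain ⟨l, hl⟩ := Quot.exists_rep (gp r).roots
  change (l : Multiset F) = _ at hl
  rw [← hl] at e hc
  rw [Multiset.coe_card] at hc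
  refine ⟨fun i => l.get (i.cast hc.symm), ?_⟩
  rw [e]
  simp only [Multiset.map_coe, Multiset.prod_coe]
  rw [← List.prod_ofFn]
  congr 1
  apply List.ext_getElem
  · rw [List.length_ofFn, List.length_map, hc]
  · intro n h1 h2
    rw [List.getElem_ofFn, List.getElem_map]
    rfl

lemma p10_map {F G : Type*} [Field F] [Field G] (φ : F →+* G) (u : F) : φ (Cub.p10 u) = Cub.p10 (φ u) := by
  simp only [Cub.p10, map_add, map_sub, map_mul, map_pow, map_ofNat]

lemma w_map {F G : Type*} [Field F] [Field G] (φ : F →+* G) (u r : F) :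
    φ (Cub.w u r) = Cub.w (φ u) (φ r) := by
  simp only [Cub.w, map_add, map_sub, map_neg, map_mul, map_div₀, map_pow, map_ofNat]

lemma gal_card0 (Ω : Type) [Field Ω] [CharZero Ω] [IsAlgClosed Ω] [Algebra.IsAlgebraic ℚ Ω] :
    Nat.card f2.Gal = 720 := by
  have hac : IsAlgClosure ℚ Ω := ⟨inferInstance, inferInstance⟩
  have hno : Normal ℚ Ω := IsAlgClosure.normal ℚ Ω
  obtain ⟨r, hr⟩ := IsAlgClosed.exists_pow_nat_eq (10 : Ω) (n := 2) (by norm_num)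
  obtain ⟨u, hu⟩ : ∃ u : Ω, Cub.p10 u = 0 := by
    have hd : (X^10 - 40*X^7 + 32*X^5 + 810*X^2 - 1944 : Polynomial Ω).degree ≠ 0 := by
      have : (X^10 - 40*X^7 + 32*X^5 + 810*X^2 - 1944 : Polynomial Ω).degree = 10 := by compute_degree!
      rw [this]; norm_num
    obtain ⟨u, hu⟩ := IsAlgClosed.exists_root _ hd
    refine ⟨u, ?_⟩
    simpa [Cub.p10, IsRoot] using hu
  obtain ⟨s, hs⟩ := IsAlgClosed.exists_pow_nat_eq (Cub.w u r) (n := 2) (by norm_num)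
  obtain ⟨s', hs'⟩ := IsAlgClosed.exists_pow_nat_eq (Cub.w u (-r)) (n := 2) (by norm_num)
  obtain ⟨a, h⟩ := roots6 r
  obtain ⟨b, h'⟩ := roots6 (-r)
  let S : Set Ω := {r, u, s, s'} ∪ (Set.range a ∪ Set.range b)
  have hfin : S.Finite := (Set.toFinite _).union ((Set.finite_range a).union (Set.finite_range b))
  let M := IntermediateField.adjoin ℚ S
  have : FiniteDimensional ℚ M := by
    have := hfin.to_subtype
    exact IntermediateField.finiteDimensional_adjoin fun x _ => Algebra.IsIntegral.isIntegral x
  let L := IntermediateField.normalClosure ℚ M Ω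
  have hSL : S ⊆ L := fun x hx => IntermediateField.le_normalClosure M (IntermediateField.subset_adjoin ℚ S hx)
  have : FiniteDimensional ℚ L := normalClosure.is_finiteDimensional ℚ M Ω
  have : Normal ℚ L := normalClosure.normal ℚ M Ω
  have : IsGalois ℚ L := ⟨⟩
  have : NumberField L := ⟨⟩
  have ma : ∀ i, a i ∈ L := fun i => hSL (Or.inr (Or.inl ⟨i, rfl⟩))
  have mb : ∀ i, b i ∈ L := fun i => hSL (Or.inr (Or.inr ⟨i, rfl⟩))
  have mr : r ∈ L := hSL (Or.inl (by simp))
  have mu : u ∈ L := hSL (Or.inl (by simp))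
  have ms : s ∈ L := hSL (Or.inl (by simp))
  have ms' : s' ∈ L := hSL (Or.inl (by simp))
  have inj : Function.Injective (algebraMap L Ω) := (algebraMap L Ω).injective
  refine gal_card (L := L) ⟨u, mu⟩ ⟨r, mr⟩ ⟨s, ms⟩ ⟨s', ms'⟩ ?_ ?_ ?_ ?_ (fun i => ⟨a i, ma i⟩)
    (fun i => ⟨b i, mb i⟩) ?_ ?_
  · exact inj hr
  · apply inj
    rw [map_zero, p10_map]
    exact hu
  · apply inj
    rw [w_map]
    exact hs
  · apply inj
    rw [w_map]
    exact hs'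
  · apply Polynomial.map_injective _ inj
    rw [Polynomial.map_prod, gp_map]
    simp only [Polynomial.map_sub, map_X, map_C]
    exact h
  · apply Polynomial.map_injective _ inj
    rw [Polynomial.map_prod, gp_map]
    simp only [Polynomial.map_sub, map_X, map_C]
    exact h'

lemma gal_card' : Nat.card f2.Gal = 720 := by
  have : Algebra.IsAlgebraic ℚ (AlgebraicClosure ℚ) := by
    convert AlgebraicClosure.isAlgebraic ℚ using 1
    first | rfl | exact Subsingleton.elim (α := Algebra ℚ (AlgebraicClosure ℚ)) _ _
    all_goals first | rfl | exact Subsingleton.elim (α := Algebra ℚ (AlgebraicClosure ℚ)) _ _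
  exact gal_card0 (AlgebraicClosure ℚ)

theorem m10_field_disc_2_5 :
    Irreducible f2 ∧ f2.natDegree = 12 ∧
    Nat.card f2.Gal = 720 ∧
    ∀ (K : Type) [Field K] [NumberField K],
      Nonempty (AdjoinRoot f2 ≃ₐ[ℚ] K) →
      Module.finrank ℚ K = 12 ∧
      NumberField.discr K = 2 ^ 38 * 5 ^ 12 := by
  refine ⟨f2_irr, f2_deg, gal_card', ?_⟩
  rintro K _ _ ⟨e⟩
  have hK : Module.finrank ℚ K = 12 := by
    rw [← e.toLinearEquiv.finrank_eq, (AdjoinRoot.powerBasis f2_irr.ne_zero).finrank, AdjoinRoot.powerBasis_dim, f2_deg]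
  refine ⟨hK, discr_eq hK (e (AdjoinRoot.root f2)) ?_⟩
  have := aeval_algHom_apply e (AdjoinRoot.root f2) f2
  rw [this, AdjoinRoot.aeval_eq, AdjoinRoot.mk_self, map_zero]
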